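/- arXiv:2201.11958 — 2 statements merged into one kernel-verified Lean document; each statement's English description precedes it below -/
import Mathlib

section
/- Let n be an even integer with n ≥ 4 and let m ≥ 4. Then the Wiener index of the comb orientation C_{m,n} of the grid G_{m,n} satisfies W(C_{m,n}) = (1/12)·(2m³n³ + 2m³n² + 2m³n + 4m³ + 4m²n³ − 3m²n² − m²n − 6m² − 2mn³ + 4mn² − 2mn − 16m + 24n² − 72n + 72 + β), where β = 3n − 6 if m is odd and β = 0 if m is even. -/
/-- Directed distance in a digraph with arc relation `A`: the length of a
shortest directed walk from `u` to `v`, with value `0` if no such walk exists. -/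
noncomputable def ddist {V : Type*} (A : V → V → Prop) (u v : V) : ℕ :=
  sInf {k : ℕ | ∃ f : ℕ → V, f 0 = u ∧ f k = v ∧ ∀ i < k, A (f i) (f (i + 1))}

/-- Wiener index of a digraph: the sum of `ddist` over all ordered pairs of vertices. -/
noncomputable def wiener {V : Type*} [Fintype V] (A : V → V → Prop) : ℕ :=
  ∑ u : V, ∑ v : V, ddist A u v

/-- The comb orientation `C_{m,n}` of the grid `G_{m,n}` (`0`-indexed: vertex `(a, b)`
is the paper's vertex `(a+1, b+1)`, i.e. row `a+1` and column `b+1`). -/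
def CombArc (m n : ℕ) (p q : Fin m × Fin n) : Prop :=
  -- horizontal arcs
  (p.1 = q.1 ∧ (
     -- row 1 directed rightward
     ((p.1 : ℕ) = 0 ∧ (q.2 : ℕ) = (p.2 : ℕ) + 1) ∨
     -- row 2: rightward between odd and even columns, leftward between even and odd
     ((p.1 : ℕ) = 1 ∧ Even (p.2 : ℕ) ∧ (q.2 : ℕ) = (p.2 : ℕ) + 1) ∨
     ((p.1 : ℕ) = 1 ∧ Odd (q.2 : ℕ) ∧ (p.2 : ℕ) = (q.2 : ℕ) + 1) ∨
     -- row m: leftward between odd and even columns, rightward between even and odd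
     ((p.1 : ℕ) + 1 = m ∧ Odd (p.2 : ℕ) ∧ (q.2 : ℕ) = (p.2 : ℕ) + 1) ∨
     ((p.1 : ℕ) + 1 = m ∧ Even (q.2 : ℕ) ∧ (p.2 : ℕ) = (q.2 : ℕ) + 1) ∨
     -- rows 3 … m−1 directed rightward
     (2 ≤ (p.1 : ℕ) ∧ (p.1 : ℕ) + 2 ≤ m ∧ (q.2 : ℕ) = (p.2 : ℕ) + 1))) ∨
  -- vertical arcs
  (p.2 = q.2 ∧ (
     -- column 1 directed upward
     ((p.2 : ℕ) = 0 ∧ (p.1 : ℕ) = (q.1 : ℕ) + 1) ∨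
     -- column n directed downward
     ((p.2 : ℕ) + 1 = n ∧ (q.1 : ℕ) = (p.1 : ℕ) + 1) ∨
     -- columns 2 … n−1: the edge between rows 1 and 2 is directed (2,j)→(1,j)
     (1 ≤ (p.2 : ℕ) ∧ (p.2 : ℕ) + 2 ≤ n ∧ (p.1 : ℕ) = 1 ∧ (q.1 : ℕ) = 0) ∨
     -- odd columns 3 … n−1 directed upward in rows 2 … m
     (1 ≤ (p.2 : ℕ) ∧ (p.2 : ℕ) + 2 ≤ n ∧ Even (p.2 : ℕ) ∧
       2 ≤ (p.1 : ℕ) ∧ (p.1 : ℕ) = (q.1 : ℕ) + 1) ∨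
     -- even columns 2 … n−2 directed downward in rows 2 … m
     (1 ≤ (p.2 : ℕ) ∧ (p.2 : ℕ) + 2 ≤ n ∧ Odd (p.2 : ℕ) ∧
       1 ≤ (p.1 : ℕ) ∧ (q.1 : ℕ) = (p.1 : ℕ) + 1)))

theorem ddist_eq_of_potential {V : Type*} [Finite V] {A : V → V → Prop} (t : V) (φ : V → ℤ)
    (h0 : φ t = 0) (hstep : ∀ x y, A x y → φ x ≤ φ y + 1)
    (hdesc : ∀ x, x ≠ t → ∃ y, A x y ∧ φ y + 1 ≤ φ x) (x : V) :
    (ddist A x t : ℤ) = φ x := by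
  have hmin : ∀ y, 0 ≤ φ y := by
    have : Nonempty V := ⟨t⟩
    obtain ⟨z, hz⟩ := Finite.exists_min φ
    intro y
    by_cases hzt : z = t
    · have := hz y
      rw [hzt, h0] at this
      exact this
    · obtain ⟨w, -, hw⟩ := hdesc z hzt
      have := hz w
      omega
  have hwalk : ∀ (k : ℕ) (x : V), φ x = k →
      ∃ f : ℕ → V, f 0 = x ∧ f k = t ∧ ∀ i < k, A (f i) (f (i + 1)) := by
    intro k
    induction k with
    | zero =>
      intro x hx
      refine ⟨fun _ => x, rfl, ?_, by simp⟩
      by_contra hxt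
      obtain ⟨y, -, hy⟩ := hdesc x hxt
      have := hmin y
      push_cast at hx
      omega
    | succ k ih =>
      intro x hx
      have hxt : x ≠ t := by
        rintro rfl
        push_cast at hx
        omega
      obtain ⟨y, hxy, hy⟩ := hdesc x hxt
      have hs := hstep x y hxy
      obtain ⟨f, hf0, hfk, hf⟩ := ih y (by push_cast at hx; omega)
      refine ⟨fun i => if i = 0 then x else f (i - 1), by simp, by simpa using hfk, ?_⟩
      intro i hi
      rcases i with _ | i
      · simpa [hf0] using hxy
      · simpa using hf i (by omega)
  have hlower : ∀ (k : ℕ) (x : V),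
      (∃ f : ℕ → V, f 0 = x ∧ f k = t ∧ ∀ i < k, A (f i) (f (i + 1))) → φ x ≤ k := by
    intro k
    induction k with
    | zero =>
      rintro x ⟨f, rfl, hft, -⟩
      simp [hft, h0]
    | succ k ih =>
      rintro x ⟨f, rfl, hft, hf⟩
      have h1 := hstep _ _ (hf 0 (by omega))
      have h2 := ih (f 1) ⟨fun i => f (i + 1), rfl, hft, fun i hi => hf (i + 1) (by omega)⟩
      push_cast
      simp only [zero_add] at h1
      omega
  have hx : φ x = ((φ x).toNat : ℤ) := (Int.toNat_of_nonneg (hmin x)).symm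
  have hmem := hwalk _ x hx
  have hle : ddist A x t ≤ (φ x).toNat := Nat.sInf_le hmem
  have hge := hlower _ x (Nat.sInf_mem (s := {k : ℕ | ∃ f : ℕ → V, f 0 = x ∧ f k = t ∧
    ∀ i < k, A (f i) (f (i + 1))}) ⟨_, hmem⟩)
  change φ x ≤ (ddist A x t : ℤ) at hge
  omega

/-- Length of the route from `(a, b)` to `(c, d)` in `C_{h+1,n}` that follows the Hamiltonian
cycle through the columns from right to left, entered through row `0` if `a = 0`. -/
def snakeDist (h n a b c d : ℤ) : ℤ :=
  (if a = 0 then n * h - b * h + n - b else if b % 2 = 0 then a else h - a + 1) +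
    (b * h - h - d * h) + (if d % 2 = 0 then h - c else if c = 0 then 1 else c - 1)

/-- Distance from `(a, b)` to `(c, b)` in `C_{h+1,n}` for `a ≠ 0`. -/
def columnDist (h n a b c : ℤ) : ℤ :=
  if b % 2 = 0 then
    if c ≤ a then a - c
    else if b = 0 then 2 * h + 2 - a - c
    else min (a + c) (2 * h + 2 - a - c)
  else
    if a ≤ c then c - a
    else if b = n - 1 then 2 * h + 2 - a - c
    else if c = 0 then (if a = 1 then 1 else a + 2)
    else min (a + c) (2 * h + 2 - a - c)

/-- Distance from `(a, b)` to `(c, d)` in `C_{h+1,n}` for `a ≠ 0` and `b < d`. -/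
def rightDist (h a b c d : ℤ) : ℤ :=
  max (a - c) (c - a) + (d - b) +
    ((if a = 1 ∧ c = 1 ∧ ¬(b % 2 = 0 ∧ d = b + 1) then 2 else 0) +
      (if a = h ∧ c = h ∧ ¬(b % 2 = 1 ∧ d = b + 1) then 2 else 0))

/-- Distance from `(0, b)` to `(c, d)` in `C_{h+1,n}`. -/
def topDist (h n b c d : ℤ) : ℤ :=
  if c = 0 ∧ b ≤ d then d - b
  else if d = n - 1 then c + n - 1 - b
  else snakeDist h n 0 b c d

/-- Distance from `(a, b)` to `(c, d)` in `C_{h+1,n}`. -/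
def combDist (h n a b c d : ℤ) : ℤ :=
  if a = 0 then topDist h n b c d
  else if d < b then snakeDist h n a b c d
  else if d = b then columnDist h n a b c
  else rightDist h a b c d

theorem combDist_top {h n b c d : ℤ} : combDist h n 0 b c d = topDist h n b c d := if_pos rfl

theorem combDist_of_lt {h n a b c d : ℤ} (ha : 1 ≤ a) (hd : d < b) :
    combDist h n a b c d = snakeDist h n a b c d := by
  rw [combDist, if_neg (by omega), if_pos hd]

theorem combDist_self {h n a b c : ℤ} (ha : 1 ≤ a) :
    combDist h n a b c b = columnDist h n a b c := by
  rw [combDist, if_neg (by omega), if_neg (lt_irrefl b), if_pos rfl]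

theorem combDist_of_gt {h n a b c d : ℤ} (ha : 1 ≤ a) (hd : b < d) :
    combDist h n a b c d = rightDist h a b c d := by
  rw [combDist, if_neg (by omega), if_neg (by omega), if_neg (by omega)]

/-- Linear facts about the products that occur in `combDist`. -/
theorem comb_products {h n b d : ℤ} (hh : 0 ≤ h) (hbn : b < n) :
    (b + 1) * h = b * h + h ∧ (b - 1) * h = b * h - h ∧ (d + 1 < n → d * h + 2 * h ≤ n * h) ∧
      b * h + h ≤ n * h ∧ (b ≤ d → b * h ≤ d * h) ∧ (b < d → b * h + h ≤ d * h) ∧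
      (d ≤ b → d * h ≤ b * h) ∧ (d < b → d * h + h ≤ b * h) := by
  refine ⟨by ring, by ring, fun _ => by nlinarith, by nlinarith, fun _ => by nlinarith,
    fun _ => by nlinarith, fun _ => by nlinarith, fun _ => by nlinarith⟩

section Step

variable {h n a b c d : ℤ} (hh : 3 ≤ h) (hn : n % 2 = 0) (ha : 0 ≤ a) (hah : a ≤ h)
  (hb : 0 ≤ b) (hbn : b < n) (hc : 0 ≤ c) (hch : c ≤ h) (hd : 0 ≤ d) (hdn : d < n)
include hh hn ha hah hb hbn hc hch hd hdn

theorem combDist_le_right (hbn' : b + 1 < n)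
    (harc : a = 0 ∨ (a = 1 ∧ b % 2 = 0) ∨ (a + 1 = h + 1 ∧ b % 2 = 1) ∨ (2 ≤ a ∧ a + 1 ≤ h)) :
    combDist h n a b c d ≤ combDist h n a (b + 1) c d + 1 := by
  obtain ⟨h1, -, h2, h3, h4, h5, h6, h7⟩ :=
    comb_products (d := d) (show 0 ≤ h by omega) hbn
  rcases ha.eq_or_lt with rfl | ha1
  · simp only [combDist_top, topDist, snakeDist, h1]
    split_ifs <;> omega
  replace ha1 : 1 ≤ a := ha1
  rcases lt_or_ge d b with hdb | hdb
  · rw [combDist_of_lt ha1 hdb, combDist_of_lt ha1 (by omega)]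
    simp only [snakeDist, h1, if_neg (show ¬ a = 0 by omega)]
    split_ifs <;> omega
  rcases hdb.eq_or_lt with rfl | hdb
  · rw [combDist_self ha1, combDist_of_lt ha1 (by omega)]
    simp only [columnDist, snakeDist, h1, if_neg (show ¬ a = 0 by omega)]
    split_ifs <;> omega
  rw [combDist_of_gt ha1 hdb]
  rcases (show b + 1 ≤ d from hdb).eq_or_lt with rfl | hdb
  · rw [combDist_self ha1]
    simp only [columnDist, rightDist, and_true]
    split_ifs <;> omega
  · rw [combDist_of_gt ha1 hdb]
    simp only [rightDist]
    split_ifs <;> omega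

omit hb in
theorem combDist_le_left (hb1 : 1 ≤ b)
    (harc : (a = 1 ∧ b % 2 = 0) ∨ (a + 1 = h + 1 ∧ b % 2 = 1)) :
    combDist h n a b c d ≤ combDist h n a (b - 1) c d + 1 := by
  obtain ⟨-, h1, h2, h3, h4, h5, h6, h7⟩ :=
    comb_products (d := d) (show 0 ≤ h by omega) hbn
  have ha1 : 1 ≤ a := by omega
  rcases lt_or_ge d (b - 1) with hdb | hdb
  · rw [combDist_of_lt ha1 hdb, combDist_of_lt ha1 (by omega)]
    simp only [snakeDist, h1, if_neg (show ¬ a = 0 by omega)]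
    split_ifs <;> omega
  rcases hdb.eq_or_lt with rfl | hdb
  · rw [combDist_self ha1, combDist_of_lt ha1 (by omega)]
    simp only [columnDist, snakeDist, h1, if_neg (show ¬ a = 0 by omega)]
    split_ifs <;> omega
  rw [combDist_of_gt ha1 hdb]
  rcases (show b ≤ d by omega).eq_or_lt with rfl | hdb
  · rw [combDist_self ha1]
    simp only [columnDist, rightDist]
    split_ifs <;> omega
  · rw [combDist_of_gt ha1 hdb]
    simp only [rightDist]
    split_ifs <;> omega

theorem combDist_le_down (hah' : a + 1 ≤ h)
    (harc : b + 1 = n ∨ (1 ≤ a ∧ b % 2 = 1)) :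
    combDist h n a b c d ≤ combDist h n (a + 1) b c d + 1 := by
  obtain ⟨-, -, h2, h3, h4, h5, h6, h7⟩ :=
    comb_products (d := d) (show 0 ≤ h by omega) hbn
  rcases ha.eq_or_lt with rfl | ha1
  · rw [combDist_top]
    rcases (show d ≤ b by omega).eq_or_lt with rfl | hdb
    · rw [combDist_self (by omega)]
      simp only [topDist, columnDist, snakeDist]
      split_ifs <;> omega
    · rw [combDist_of_lt (by omega) hdb]
      have : b * h + h = n * h := by
        obtain rfl : n = b + 1 := by omega
        ring
      simp only [topDist, snakeDist]
      split_ifs <;> omega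
  replace ha1 : 1 ≤ a := ha1
  have ha2 : 1 ≤ a + 1 := by omega
  rcases lt_trichotomy d b with hdb | rfl | hdb
  · rw [combDist_of_lt ha1 hdb, combDist_of_lt ha2 hdb]
    simp only [snakeDist, if_neg (show ¬ a = 0 by omega), if_neg (show ¬ a + 1 = 0 by omega)]
    split_ifs <;> omega
  · rw [combDist_self ha1, combDist_self ha2]
    simp only [columnDist]
    split_ifs <;> omega
  · rw [combDist_of_gt ha1 hdb, combDist_of_gt ha2 hdb]
    simp only [rightDist]
    split_ifs <;> omega

theorem combDist_le_up (ha1 : 1 ≤ a)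
    (harc : b = 0 ∨ (b + 2 ≤ n ∧ a = 1) ∨ (b % 2 = 0)) :
    combDist h n a b c d ≤ combDist h n (a - 1) b c d + 1 := by
  obtain ⟨-, -, h2, h3, h4, h5, h6, h7⟩ :=
    comb_products (d := d) (show 0 ≤ h by omega) hbn
  rcases ha1.eq_or_lt with rfl | ha2
  · rw [show (1 : ℤ) - 1 = 0 by norm_num, combDist_top]
    rcases lt_trichotomy d b with hdb | rfl | hdb
    · rw [combDist_of_lt ha1 hdb]
      simp only [snakeDist, topDist]
      split_ifs <;> omega
    · rw [combDist_self ha1]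
      simp only [columnDist, topDist, snakeDist]
      split_ifs <;> omega
    · rw [combDist_of_gt ha1 hdb]
      simp only [rightDist, topDist, snakeDist]
      split_ifs <;> omega
  replace ha2 : 1 ≤ a - 1 := by omega
  rcases lt_trichotomy d b with hdb | rfl | hdb
  · rw [combDist_of_lt ha1 hdb, combDist_of_lt ha2 hdb]
    simp only [snakeDist, if_neg (show ¬ a = 0 by omega), if_neg (show ¬ a - 1 = 0 by omega)]
    split_ifs <;> omega
  · rw [combDist_self ha1, combDist_self ha2]
    simp only [columnDist]
    split_ifs <;> omega
  · rw [combDist_of_gt ha1 hdb, combDist_of_gt ha2 hdb]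
    simp only [rightDist]
    split_ifs <;> omega

omit ha hah hch hd in
theorem exists_descent_top (hne : ¬(c = 0 ∧ d = b)) :
    (b + 1 < n ∧ combDist h n 0 (b + 1) c d + 1 ≤ combDist h n 0 b c d) ∨
      (b + 1 = n ∧ combDist h n (0 + 1) b c d + 1 ≤ combDist h n 0 b c d) := by
  obtain ⟨h1, -, h2, h3, h4, h5, h6, h7⟩ := comb_products (d := d) (show 0 ≤ h by omega) hbn
  by_cases hb1 : b + 1 < n
  · refine Or.inl ⟨hb1, ?_⟩
    simp only [combDist_top, topDist, snakeDist, h1]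
    split_ifs <;> omega
  · refine Or.inr ⟨by omega, ?_⟩
    rw [combDist_top]
    rcases (show d ≤ b by omega).eq_or_lt with rfl | hdb
    · rw [combDist_self (by omega)]
      simp only [topDist, columnDist, snakeDist]
      split_ifs <;> omega
    · rw [combDist_of_lt (by omega) hdb]
      have : b * h + h = n * h := by
        obtain rfl : n = b + 1 := by omega
        ring
      simp only [topDist, snakeDist]
      split_ifs <;> omega

omit ha hb in
theorem exists_descent_of_lt (ha1 : 1 ≤ a) (hdb : d < b) :
    (a + 1 ≤ h ∧ b % 2 = 1 ∧ combDist h n (a + 1) b c d + 1 ≤ combDist h n a b c d) ∨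
      (((a = 1 ∧ b % 2 = 0) ∨ (a = h ∧ b % 2 = 1)) ∧
        combDist h n a (b - 1) c d + 1 ≤ combDist h n a b c d) ∨
      (b % 2 = 0 ∧ combDist h n (a - 1) b c d + 1 ≤ combDist h n a b c d) := by
  obtain ⟨-, h1, h2, h3, h4, h5, h6, h7⟩ := comb_products (d := d) (show 0 ≤ h by omega) hbn
  rw [combDist_of_lt ha1 hdb]
  by_cases hl : (a = 1 ∧ b % 2 = 0) ∨ (a = h ∧ b % 2 = 1)
  · refine Or.inr (Or.inl ⟨hl, ?_⟩)
    rcases (show d ≤ b - 1 by omega).eq_or_lt with rfl | hdb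
    · rw [combDist_self ha1]
      simp only [columnDist, snakeDist, h1, if_neg (show ¬ a = 0 by omega)]
      split_ifs <;> omega
    · rw [combDist_of_lt ha1 hdb]
      simp only [snakeDist, h1, if_neg (show ¬ a = 0 by omega)]
      split_ifs <;> omega
  by_cases hb2 : b % 2 = 0
  · refine Or.inr (Or.inr ⟨hb2, ?_⟩)
    rw [combDist_of_lt (by omega) hdb]
    simp only [snakeDist]
    split_ifs <;> omega
  · refine Or.inl ⟨by omega, by omega, ?_⟩
    rw [combDist_of_lt (by omega) hdb]
    simp only [snakeDist]
    split_ifs <;> omega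

omit hd hdn in
theorem exists_descent_self (ha1 : 1 ≤ a) (hne : a ≠ c) :
    (b + 1 < n ∧ ((a = 1 ∧ b % 2 = 0) ∨ (a = h ∧ b % 2 = 1) ∨ (2 ≤ a ∧ a + 1 ≤ h)) ∧
        combDist h n a (b + 1) c b + 1 ≤ combDist h n a b c b) ∨
      (1 ≤ b ∧ ((a = 1 ∧ b % 2 = 0) ∨ (a = h ∧ b % 2 = 1)) ∧
        combDist h n a (b - 1) c b + 1 ≤ combDist h n a b c b) ∨
      (a + 1 ≤ h ∧ b % 2 = 1 ∧ combDist h n (a + 1) b c b + 1 ≤ combDist h n a b c b) ∨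
      (((b + 2 ≤ n ∧ a = 1) ∨ b % 2 = 0) ∧
        combDist h n (a - 1) b c b + 1 ≤ combDist h n a b c b) := by
  obtain ⟨h1, -, h2, h3, h4, h5, h6, h7⟩ := comb_products (d := b) (show 0 ≤ h by omega) hbn
  have hR := combDist_of_lt (h := h) (n := n) (c := c) ha1 (show b < b + 1 by omega)
  have hL := combDist_of_gt (h := h) (n := n) (c := c) ha1 (show b - 1 < b by omega)
  have hD : combDist h n (a + 1) b c b = _ := combDist_self (by omega)
  have hU : 2 ≤ a → combDist h n (a - 1) b c b = _ := fun _ => combDist_self (by omega)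
  rw [combDist_self ha1, hR, hL, hD]
  by_cases hb2 : b % 2 = 0
  · rcases lt_or_gt_of_ne hne with hac | hac
    · by_cases hr : b = 0 ∨ 2 * h + 2 - a - c ≤ a + c
      · refine Or.inl ⟨by omega, by omega, ?_⟩
        simp only [columnDist, snakeDist, h1, if_neg (show ¬ a = 0 by omega)]
        split_ifs <;> omega
      · by_cases ha2 : a = 1
        · refine Or.inr (Or.inl ⟨by omega, by omega, ?_⟩)
          simp only [columnDist, rightDist]
          split_ifs <;> omega
        · refine Or.inr (Or.inr (Or.inr ⟨by omega, ?_⟩))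
          rw [hU (by omega)]
          simp only [columnDist]
          split_ifs <;> omega
    · refine Or.inr (Or.inr (Or.inr ⟨by omega, ?_⟩))
      by_cases ha2 : a = 1
      · subst ha2
        rw [show (1 : ℤ) - 1 = 0 by norm_num, combDist_top]
        simp only [columnDist, topDist, snakeDist]
        split_ifs <;> omega
      · rw [hU (by omega)]
        simp only [columnDist]
        split_ifs <;> omega
  · rcases lt_or_gt_of_ne hne with hac | hac
    · refine Or.inr (Or.inr (Or.inl ⟨by omega, by omega, ?_⟩))
      simp only [columnDist]
      split_ifs <;> omega
    · by_cases ha2 : b + 2 ≤ n ∧ a = 1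
      · refine Or.inr (Or.inr (Or.inr ⟨by omega, ?_⟩))
        obtain ⟨-, rfl⟩ := ha2
        rw [show (1 : ℤ) - 1 = 0 by norm_num, combDist_top]
        simp only [columnDist, topDist, snakeDist]
        split_ifs <;> omega
      · by_cases hr : b + 1 < n ∧ (c = 0 ∨ a + c ≤ 2 * h + 2 - a - c)
        · refine Or.inl ⟨by omega, by omega, ?_⟩
          simp only [columnDist, snakeDist, h1, if_neg (show ¬ a = 0 by omega)]
          split_ifs <;> omega
        · by_cases hah' : a = h
          · refine Or.inr (Or.inl ⟨by omega, by omega, ?_⟩)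
            simp only [columnDist, rightDist]
            split_ifs <;> omega
          · refine Or.inr (Or.inr (Or.inl ⟨by omega, by omega, ?_⟩))
            simp only [columnDist]
            split_ifs <;> omega

theorem exists_descent_of_gt (ha1 : 1 ≤ a) (hdb : b < d) :
    (((a = 1 ∧ b % 2 = 0) ∨ (a = h ∧ b % 2 = 1) ∨ (2 ≤ a ∧ a + 1 ≤ h)) ∧
        combDist h n a (b + 1) c d + 1 ≤ combDist h n a b c d) ∨
      (a + 1 ≤ h ∧ b % 2 = 1 ∧ combDist h n (a + 1) b c d + 1 ≤ combDist h n a b c d) ∨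
      (((b + 2 ≤ n ∧ a = 1) ∨ b % 2 = 0) ∧
        combDist h n (a - 1) b c d + 1 ≤ combDist h n a b c d) := by
  have hD := combDist_of_gt (h := h) (n := n) (c := c) (show 1 ≤ a + 1 by omega) hdb
  have hU : 2 ≤ a → combDist h n (a - 1) b c d = _ := fun _ => combDist_of_gt (by omega) hdb
  have hU' : a = 1 → combDist h n (a - 1) b c d = topDist h n b c d := by
    rintro rfl
    exact combDist_top
  rw [combDist_of_gt ha1 hdb, hD]
  by_cases hu : (b % 2 = 0 ∧ ((c < a ∧ ¬(a = 2 ∧ c = 1 ∧ b + 1 < d)) ∨ (a = h ∧ c = h))) ∨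
      (b % 2 = 1 ∧ a = 1 ∧ c = 0)
  · refine Or.inr (Or.inr ⟨by omega, ?_⟩)
    by_cases ha2 : a = 1
    · rw [hU' ha2]
      simp only [rightDist, topDist]
      split_ifs <;> omega
    · rw [hU (by omega)]
      simp only [rightDist]
      split_ifs <;> omega
  by_cases hdn : b % 2 = 1 ∧ ((a < c ∧ ¬(a + 1 = h ∧ c = h ∧ b + 1 < d)) ∨ (a = 1 ∧ c = 1))
  · refine Or.inr (Or.inl ⟨by omega, by omega, ?_⟩)
    simp only [rightDist]
    split_ifs <;> omega
  refine Or.inl ⟨by omega, ?_⟩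
  rcases (show b + 1 ≤ d from hdb).eq_or_lt with rfl | hdb
  · rw [combDist_self ha1]
    simp only [columnDist, rightDist, and_true]
    split_ifs <;> omega
  · rw [combDist_of_gt ha1 hdb]
    simp only [rightDist]
    split_ifs <;> omega

end Step

/-- Adjacency of `(a, b)` to `(a', b')` in `C_{h+1,n}` for even `n`, by direction of the arc. -/
theorem combArc_iff {h n : ℕ} (hh : 3 ≤ h) (hn : Even n) {a b a' b' : ℕ} (ha : a < h + 1)
    (hb : b < n) (ha' : a' < h + 1) (hb' : b' < n) :
    CombArc (h + 1) n (⟨a, ha⟩, ⟨b, hb⟩) (⟨a', ha'⟩, ⟨b', hb'⟩) ↔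
      (a' = a ∧ b' = b + 1 ∧ (a = 0 ∨ (a = 1 ∧ b % 2 = 0) ∨ (a = h ∧ b % 2 = 1) ∨
        (2 ≤ a ∧ a + 1 ≤ h))) ∨
      (a' = a ∧ b = b' + 1 ∧ ((a = 1 ∧ b % 2 = 0) ∨ (a = h ∧ b % 2 = 1))) ∨
      (a' = a + 1 ∧ b' = b ∧ (b + 1 = n ∨ (1 ≤ a ∧ b % 2 = 1))) ∨
      (a = a' + 1 ∧ b' = b ∧ (b = 0 ∨ (b + 2 ≤ n ∧ a = 1) ∨ b % 2 = 0)) := by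
  have hn2 : n % 2 = 0 := Nat.even_iff.mp hn
  simp only [CombArc, Fin.mk.injEq, Nat.odd_iff, Nat.even_iff]
  constructor
  · rintro (⟨rfl, H⟩ | ⟨rfl, H⟩) <;> omega
  · rintro (⟨rfl, rfl, H⟩ | ⟨rfl, rfl, H⟩ | ⟨rfl, rfl, H⟩ | ⟨rfl, rfl, H⟩)
    · refine Or.inl ⟨rfl, ?_⟩
      simp only [and_true]
      omega
    · refine Or.inl ⟨rfl, ?_⟩
      simp only [and_true]
      omega
    · refine Or.inr ⟨rfl, ?_⟩
      simp only [and_true]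
      omega
    · refine Or.inr ⟨rfl, ?_⟩
      simp only [and_true]
      omega

theorem exists_descent {h n a b c d : ℕ} (hh : 3 ≤ h) (hn2 : n % 2 = 0) (ha : a < h + 1)
    (hb : b < n) (hc : c < h + 1) (hd : d < n) (hne : ¬(a = c ∧ b = d)) :
    ((b + 1 < n ∧ (a = 0 ∨ (a = 1 ∧ b % 2 = 0) ∨ (a = h ∧ b % 2 = 1) ∨
        (2 ≤ a ∧ a + 1 ≤ h))) ∧
        combDist h n a (b + 1) c d + 1 ≤ combDist h n a b c d) ∨
      ((1 ≤ b ∧ ((a = 1 ∧ b % 2 = 0) ∨ (a = h ∧ b % 2 = 1))) ∧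
        combDist h n a (b - 1) c d + 1 ≤ combDist h n a b c d) ∨
      ((a + 1 ≤ h ∧ (b + 1 = n ∨ (1 ≤ a ∧ b % 2 = 1))) ∧
        combDist h n (a + 1) b c d + 1 ≤ combDist h n a b c d) ∨
      ((1 ≤ a ∧ ((b + 2 ≤ n ∧ a = 1) ∨ b % 2 = 0)) ∧
        combDist h n (a - 1) b c d + 1 ≤ combDist h n a b c d) := by
  rcases Nat.eq_zero_or_pos a with rfl | ha1
  · rcases exists_descent_top (h := h) (n := n) (b := b) (c := c) (d := d)
      (by omega) (by omega) (by omega) (by omega)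
      (by omega) (by omega) (by omega) with ⟨h1, h2⟩ | ⟨h1, h2⟩
    · exact Or.inl ⟨by omega, by simpa using h2⟩
    · exact Or.inr (Or.inr (Or.inl ⟨by omega, by simpa using h2⟩))
  rcases lt_trichotomy d b with hdb | rfl | hdb
  · rcases exists_descent_of_lt (h := h) (n := n) (a := a) (b := b) (c := c) (d := d)
      (by omega) (by omega) (by omega) (by omega) (by omega) (by omega)
      (by omega) (by omega) (by omega) (by omega) with ⟨h1, h1', h2⟩ | ⟨h1, h2⟩ | ⟨h1, h2⟩
    · exact Or.inr (Or.inr (Or.inl ⟨by omega, h2⟩))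
    · exact Or.inr (Or.inl ⟨by omega, h2⟩)
    · exact Or.inr (Or.inr (Or.inr ⟨by omega, h2⟩))
  · rcases exists_descent_self (h := h) (n := n) (a := a) (b := d) (c := c)
      (by omega) (by omega) (by omega) (by omega) (by omega)
      (by omega) (by omega) (by omega) (by omega) (by omega)
      with ⟨h1, h1', h2⟩ | ⟨h1, h1', h2⟩ | ⟨h1, h1', h2⟩ | ⟨h1, h2⟩
    · exact Or.inl ⟨by omega, h2⟩
    · exact Or.inr (Or.inl ⟨by omega, h2⟩)
    · exact Or.inr (Or.inr (Or.inl ⟨by omega, h2⟩))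
    · exact Or.inr (Or.inr (Or.inr ⟨by omega, h2⟩))
  · rcases exists_descent_of_gt (h := h) (n := n) (a := a) (b := b) (c := c) (d := d)
      (by omega) (by omega) (by omega) (by omega) (by omega) (by omega)
      (by omega) (by omega) (by omega) (by omega) (by omega) (by omega)
      with ⟨h1, h2⟩ | ⟨h1, h1', h2⟩ | ⟨h1, h2⟩
    · exact Or.inl ⟨by omega, h2⟩
    · exact Or.inr (Or.inr (Or.inl ⟨by omega, h2⟩))
    · exact Or.inr (Or.inr (Or.inr ⟨by omega, h2⟩))

theorem ddist_combArc {h n : ℕ} (hh : 3 ≤ h) (hn : Even n) (x t : Fin (h + 1) × Fin n) :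
    (ddist (CombArc (h + 1) n) x t : ℤ) =
      combDist h n (x.1 : ℕ) (x.2 : ℕ) (t.1 : ℕ) (t.2 : ℕ) := by
  obtain ⟨⟨c, hc⟩, ⟨d, hd⟩⟩ := t
  have hn2 : n % 2 = 0 := Nat.even_iff.mp hn
  refine ddist_eq_of_potential (A := CombArc (h + 1) n) (⟨c, hc⟩, ⟨d, hd⟩)
    (fun y => combDist h n (y.1 : ℕ) (y.2 : ℕ) c d) ?_ ?_ ?_ x
  · simp only [combDist, topDist, columnDist]
    split_ifs <;> omega
  · rintro ⟨⟨a, ha⟩, ⟨b, hb⟩⟩ ⟨⟨a', ha'⟩, ⟨b', hb'⟩⟩ harc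
    dsimp only
    rcases (combArc_iff hh hn ha hb ha' hb').mp harc with
      ⟨rfl, rfl, h3⟩ | ⟨rfl, rfl, h3⟩ | ⟨rfl, rfl, h3⟩ | ⟨rfl, rfl, h3⟩
    · push_cast
      exact combDist_le_right (by omega) (by omega) (by omega) (by omega) (by omega) (by omega)
        (by omega) (by omega) (by omega) (by omega) (by omega) (by omega)
    · have := combDist_le_left (h := h) (n := n) (a := a') (b := (b' + 1 : ℕ)) (c := c) (d := d)
        (by omega) (by omega) (by omega) (by omega) (by omega)
        (by omega) (by omega) (by omega) (by omega) (by omega) (by omega)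
      simpa using this
    · push_cast
      exact combDist_le_down (by omega) (by omega) (by omega) (by omega) (by omega) (by omega)
        (by omega) (by omega) (by omega) (by omega) (by omega) (by omega)
    · have := combDist_le_up (h := h) (n := n) (a := (a' + 1 : ℕ)) (b := b') (c := c) (d := d)
        (by omega) (by omega) (by omega) (by omega) (by omega) (by omega)
        (by omega) (by omega) (by omega) (by omega) (by omega) (by omega)
      simpa using this
  · rintro ⟨⟨a, ha⟩, ⟨b, hb⟩⟩ hne
    have hne' : ¬(a = c ∧ b = d) := by
      rintro ⟨rfl, rfl⟩
      exact hne rfl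
    rcases exists_descent hh hn2 ha hb hc hd hne' with ⟨h1, h2⟩ | ⟨h1, h2⟩ | ⟨h1, h2⟩ | ⟨h1, h2⟩
    · refine ⟨(⟨a, ha⟩, ⟨b + 1, h1.1⟩), (combArc_iff hh hn _ _ _ _).mpr (by omega), ?_⟩
      push_cast
      exact h2
    · refine ⟨(⟨a, ha⟩, ⟨b - 1, by omega⟩), (combArc_iff hh hn _ _ _ _).mpr (by omega), ?_⟩
      rw [← Nat.cast_pred h1.1] at h2
      exact h2
    · refine ⟨(⟨a + 1, by omega⟩, ⟨b, hb⟩), (combArc_iff hh hn _ _ _ _).mpr (by omega), ?_⟩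
      push_cast
      exact h2
    · refine ⟨(⟨a - 1, by omega⟩, ⟨b, hb⟩), (combArc_iff hh hn _ _ _ _).mpr (by omega), ?_⟩
      rw [← Nat.cast_pred h1.1] at h2
      exact h2

section Sums

open Finset

theorem sum_sum_range_eq_triangle (f : ℕ → ℕ → ℚ) (N : ℕ) :
    ∑ i ∈ range N, ∑ j ∈ range N, f i j =
      ∑ i ∈ range N, (f i i + ∑ j ∈ range i, (f i j + f j i)) := by
  induction N with
  | zero => simp
  | succ N ih =>
    rw [sum_range_succ, sum_range_succ _ N, sum_range_succ _ N]
    simp only [sum_range_succ, sum_add_distrib] at ih ⊢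
    linarith

theorem sum_range_affine (A B : ℚ) (N : ℕ) :
    ∑ i ∈ range N, (A + B * i) = N * A + B * (N * (N - 1) / 2) :=
  sum_range_induction _ (fun N : ℕ => N * A + B * (N * (N - 1) / 2)) (by simp) N
    (fun k _ => by push_cast; ring)

theorem sum_range_min (N : ℕ) :
    ∑ i ∈ range N, min ((i : ℚ) + 1) (N - i) = (2 * ((N : ℚ) + 1) ^ 2 - 1 - (-1) ^ N) / 8 := by
  induction N using Nat.twoStepInduction with
  | zero => norm_num
  | one => norm_num
  | more N ih _ =>
    rw [sum_range_succ', sum_range_succ]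
    have : ∑ i ∈ range N, min (((i + 1 : ℕ) : ℚ) + 1) (((N + 2 : ℕ) : ℚ) - (i + 1 : ℕ)) =
        ∑ i ∈ range N, (min ((i : ℚ) + 1) (N - i) + 1) :=
      sum_congr rfl fun i _ => by
        rw [← min_add_add_right]
        push_cast
        ring_nf
    rw [this, sum_add_distrib, ih, min_eq_right, min_eq_left]
    · simp
      ring
    · push_cast
      linarith [(Nat.cast_nonneg N : (0 : ℚ) ≤ N)]
    · push_cast
      linarith [(Nat.cast_nonneg N : (0 : ℚ) ≤ N)]

/-- The sum of `min (a + c) (2 * h + 2 - a - c)` over `1 ≤ c < a ≤ h`. -/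
def detourSum (h : ℕ) : ℚ :=
  ∑ i ∈ range h, ∑ j ∈ range i, min ((i : ℚ) + j + 2) (2 * h - i - j)

theorem detourSum_eq (h : ℕ) :
    detourSum h =
      (h ^ 2 * (h + 1) - (h - 1) * h * (h + 1) / 3
        - (2 * ((h : ℚ) + 1) ^ 2 - 1 - (-1) ^ h) / 4) / 2 := by
  rw [detourSum]
  have hsym := sum_sum_range_eq_triangle (fun i j => min ((i : ℚ) + j + 2) (2 * h - i - j)) h
  have hrefl : ∀ i ∈ range h, ∑ j ∈ range h, min ((i : ℚ) + j + 2) (2 * h - i - j) =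
      ∑ j ∈ range h, ((h : ℚ) + 1 - max ((i : ℚ) - j) (j - i)) := by
    intro i _
    rw [← sum_range_reflect]
    refine sum_congr rfl fun j hj => ?_
    rw [Nat.cast_sub (by have := mem_range.mp hj; omega), Nat.cast_sub (by
      have := mem_range.mp hj; omega), Nat.cast_one]
    rcases le_total (i : ℚ) j with hij | hij
    · rw [max_eq_right (by linarith), min_eq_left (by linarith)]
      ring
    · rw [max_eq_left (by linarith), min_eq_right (by linarith)]
      ring
  rw [sum_congr rfl hrefl,
    sum_sum_range_eq_triangle (fun i j => (h : ℚ) + 1 - max ((i : ℚ) - j) (j - i)) h] at hsym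
  have hl : ∀ i ∈ range h, ((h : ℚ) + 1 - max ((i : ℚ) - i) (i - i) +
      ∑ j ∈ range i, ((h : ℚ) + 1 - max ((i : ℚ) - j) (j - i) +
        ((h : ℚ) + 1 - max ((j : ℚ) - i) (i - j)))) =
      (h + 1) * (2 * i + 1) - i * (i + 1) := by
    intro i _
    have : ∀ j ∈ range i, ((h : ℚ) + 1 - max ((i : ℚ) - j) (j - i) +
        ((h : ℚ) + 1 - max ((j : ℚ) - i) (i - j))) = 2 * (h + 1 - i) + 2 * j := by
      intro j hj
      have : (j : ℚ) < i := by exact_mod_cast mem_range.mp hj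
      rw [max_eq_left (by linarith), max_eq_right (by linarith)]
      ring
    rw [sum_congr rfl this, sum_range_affine, sub_self, max_self]
    ring
  rw [sum_congr rfl hl] at hsym
  have hr : ∀ i ∈ range h, (min ((i : ℚ) + i + 2) (2 * h - i - i) +
      ∑ j ∈ range i, (min ((i : ℚ) + j + 2) (2 * h - i - j) +
        min ((j : ℚ) + i + 2) (2 * h - j - i))) =
      2 * min ((i : ℚ) + 1) (h - i) +
        2 * ∑ j ∈ range i, min ((i : ℚ) + j + 2) (2 * h - i - j) := by
    intro i _
    congr 1
    · rw [mul_min_of_nonneg _ _ (by norm_num)]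
      ring_nf
    · rw [mul_sum]
      refine sum_congr rfl fun j _ => ?_
      rw [add_comm (j : ℚ) i, sub_right_comm (2 * (h : ℚ)) j i]
      ring
  rw [sum_congr rfl hr, sum_add_distrib, ← mul_sum, ← mul_sum, sum_range_min] at hsym
  have hq : ∑ i ∈ range h, (((h : ℚ) + 1) * (2 * i + 1) - i * (i + 1)) =
      (h + 1) * h ^ 2 - (h - 1) * h * (h + 1) / 3 := by
    have : ∀ N : ℕ, ∑ i ∈ range N, (((h : ℚ) + 1) * (2 * i + 1) - i * (i + 1)) =
        (h + 1) * N ^ 2 - (N - 1) * N * (N + 1) / 3 := fun N => by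
      induction N with
      | zero => simp
      | succ N ih =>
        rw [sum_range_succ, ih]
        push_cast
        ring
    exact this h
  rw [hq] at hsym
  linarith

theorem sum_snakeDist (h n d : ℕ) (a b : ℤ) :
    ∑ c ∈ range (h + 1), (snakeDist h n a b c d : ℚ) =
      (h + 1) * (snakeDist h n a b 0 d : ℤ) - h - (-1) ^ d * (h * (h - 1) / 2) := by
  set q : ℤ := snakeDist h n a b 0 d with hq
  rcases Nat.even_or_odd d with hd | hd
  · have hd2 : (d : ℤ) % 2 = 0 := by
      have := Nat.even_iff.mp hd
      omega
    have : ∀ c ∈ range (h + 1), (snakeDist h n a b c d : ℚ) = q + (-1) * c := by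
      intro c _
      have : snakeDist h n a b c d = q + (-1) * c := by
        rw [hq]
        simp only [snakeDist, if_pos hd2]
        ring
      rw [this]
      push_cast
      ring
    rw [sum_congr rfl this, sum_range_affine, hd.neg_one_pow]
    push_cast
    ring
  · have hd2 : ¬ (d : ℤ) % 2 = 0 := by
      have := Nat.odd_iff.mp hd
      omega
    have : ∀ c ∈ range h, (snakeDist h n a b (c + 1 : ℕ) d : ℚ) = (q - 1) + 1 * c := by
      intro c _
      have : snakeDist h n a b (c + 1 : ℕ) d = (q - 1) + c := by
        rw [hq]
        simp only [snakeDist, if_neg hd2, if_true, if_neg (show ¬ ((c + 1 : ℕ) : ℤ) = 0 by omega)]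
        push_cast
        ring
      rw [this]
      push_cast
      ring
    rw [sum_range_succ', sum_congr rfl this, sum_range_affine, hd.neg_one_pow, Nat.cast_zero, ← hq]
    ring

theorem snakeDist_top (h n d : ℕ) (b : ℤ) :
    (snakeDist h n 0 b 0 d : ℚ) =
      (n - b) * (h + 1) + (b - 1 - d) * h + (h + 1 + (h - 1) * (-1) ^ d) / 2 := by
  rcases Nat.even_or_odd d with hd | hd
  · have hd2 : (d : ℤ) % 2 = 0 := by
      have := Nat.even_iff.mp hd
      omega
    simp only [snakeDist, if_pos hd2, if_true, hd.neg_one_pow]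
    push_cast
    ring
  · have hd2 : ¬ (d : ℤ) % 2 = 0 := by
      have := Nat.odd_iff.mp hd
      omega
    simp only [snakeDist, if_neg hd2, if_true, hd.neg_one_pow]
    push_cast
    ring

theorem sum_snakeDist_zero (h n d : ℕ) (b : ℤ) :
    ∑ i ∈ range h, (snakeDist h n (i + 1 : ℕ) b 0 d : ℚ) =
      h * (h + 1) / 2 + h * ((b - 1 - d) * h + (h + 1 + (h - 1) * (-1) ^ d) / 2) := by
  have key : ∀ i : ℕ, (snakeDist h n (i + 1 : ℕ) b 0 d : ℚ) =
      (if b % 2 = 0 then (1 : ℚ) + 1 * i else h + (-1) * i) +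
        ((b - 1 - d) * h + (h + 1 + (h - 1) * (-1) ^ d) / 2) := by
    intro i
    have h1 : (snakeDist h n (i + 1 : ℕ) b 0 d : ℚ) = (snakeDist h n 0 b 0 d : ℚ) +
        ((if b % 2 = 0 then (1 : ℚ) + 1 * i else h + (-1) * i) - (n - b) * (h + 1)) := by
      simp only [snakeDist, if_neg (show ¬ ((i + 1 : ℕ) : ℤ) = 0 by omega), if_true]
      push_cast
      split_ifs <;> ring
    rw [h1, snakeDist_top]
    ring
  rw [sum_congr rfl fun i _ => key i, sum_add_distrib, sum_const, card_range, nsmul_eq_mul]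
  congr 1
  split_ifs
  · rw [sum_range_affine]
    ring
  · rw [sum_range_affine]
    ring

theorem sum_combDist_of_lt (h n b d : ℕ) (hdb : d < b) :
    ∑ i ∈ range h, ∑ c ∈ range (h + 1), (combDist h n (i + 1 : ℕ) b c d : ℚ) =
      h * (h + 1) ^ 2 / 2 + h ^ 2 * (h + 1) * (b - 1 - d) +
        h * (h ^ 2 + 1 + (h - 1) * (-1) ^ d) / 2 := by
  have key : ∀ i ∈ range h, ∑ c ∈ range (h + 1), (combDist h n (i + 1 : ℕ) b c d : ℚ) =
      (h + 1) * (snakeDist h n (i + 1 : ℕ) b 0 d : ℤ) - h - (-1) ^ d * (h * (h - 1) / 2) := by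
    intro i _
    rw [← sum_snakeDist]
    refine sum_congr rfl fun c _ => ?_
    rw [combDist_of_lt (by omega) (by omega)]
  rw [sum_congr rfl key]
  simp only [sum_sub_distrib, ← mul_sum, sum_snakeDist_zero, sum_const, card_range, nsmul_eq_mul]
  push_cast
  ring

theorem sum_topDist_of_lt (h n b d : ℕ) (hd : d + 1 < n) (hdb : d < b) :
    ∑ c ∈ range (h + 1), (topDist h n b c d : ℚ) =
      (h + 1) * ((n - b) * (h + 1) + (b - 1 - d) * h) +
        (h ^ 2 + 1 + (h - 1) * (-1) ^ d) / 2 := by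
  have key : ∀ c ∈ range (h + 1), (topDist h n b c d : ℚ) = (snakeDist h n 0 b c d : ℚ) := by
    intro c _
    rw [topDist, if_neg (by omega), if_neg (by omega)]
  rw [sum_congr rfl key, sum_snakeDist, snakeDist_top]
  push_cast
  ring

theorem sum_topDist_of_le (h n b d : ℕ) (hd : d + 1 < n) (hdb : b ≤ d) :
    ∑ c ∈ range (h + 1), (topDist h n b c d : ℚ) =
      h * ((n - b) * (h + 1) + (b - 1 - d) * h) + h * (h - 1) / 2 + (d - b) := by
  have key : ∀ c ∈ range h, (topDist h n b (c + 1 : ℕ) d : ℚ) =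
      (snakeDist h n 0 b (c + 1 : ℕ) d : ℚ) := by
    intro c _
    rw [topDist, if_neg (by omega), if_neg (by omega)]
  have h1 := sum_snakeDist h n d 0 b
  rw [sum_range_succ'] at h1
  rw [sum_range_succ', sum_congr rfl key, topDist, if_pos (by omega)]
  have h2 := snakeDist_top h n d b
  push_cast at h1 h2 ⊢
  rw [h2] at h1
  linear_combination h1

theorem sum_topDist_last (h n b d : ℕ) (hd : d + 1 = n) :
    ∑ c ∈ range (h + 1), (topDist h n b c d : ℚ) =
      h * (h + 1) / 2 + (h + 1) * (d - b) := by
  have key : ∀ c ∈ range (h + 1), (topDist h n b c d : ℚ) = ((d : ℚ) - b) + 1 * c := by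
    intro c _
    have : topDist h n b c d = d - b + c := by
      rw [topDist]
      split_ifs <;> omega
    rw [this]
    push_cast
    ring
  rw [sum_congr rfl key, sum_range_affine]
  push_cast
  ring

/-- A sum over `1 ≤ a ≤ h`, `0 ≤ c ≤ h`, split into `c = 0`, `c = a` and the pairs `{a, c}`. -/
theorem sum_sum_range_succ_eq (h : ℕ) (f : ℕ → ℕ → ℚ) :
    ∑ i ∈ range h, ∑ c ∈ range (h + 1), f (i + 1) c =
      ∑ i ∈ range h, (f (i + 1) 0 + f (i + 1) (i + 1)) +
        ∑ i ∈ range h, ∑ j ∈ range i, (f (i + 1) (j + 1) + f (j + 1) (i + 1)) := by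
  simp only [sum_range_succ' _ h, sum_add_distrib]
  rw [sum_sum_range_eq_triangle (fun i j => f (i + 1) (j + 1))]
  simp only [sum_add_distrib]
  ring

theorem sum_sum_range_sub (h : ℕ) (A B : ℚ) :
    ∑ i ∈ range h, ∑ j ∈ range i, (A + B * ((i : ℚ) - j)) =
      A * (h * (h - 1) / 2) + B * ((h - 1) * h * (h + 1) / 6) := by
  have key : ∀ N : ℕ, ∑ i ∈ range N, ∑ j ∈ range i, (A + B * ((i : ℚ) - j)) =
      A * (N * (N - 1) / 2) + B * ((N - 1) * N * (N + 1) / 6) := fun N => by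
    induction N with
    | zero => simp
    | succ N ih =>
      have : ∀ j ∈ range N, (A + B * ((N : ℚ) - j)) = (A + B * N) + (-B) * j := fun _ _ => by ring
      rw [sum_range_succ, ih, sum_congr rfl this, sum_range_affine]
      push_cast
      ring
  exact key h

theorem sum_rightDist (h b d : ℕ) (hh : 3 ≤ h) :
    ∑ i ∈ range h, ∑ c ∈ range (h + 1), (rightDist h (i + 1 : ℕ) b c d : ℚ) =
      h * (h + 1) * (2 * h + 1) / 6 + h * (h + 1) * (d - b) + 4 - (if d = b + 1 then 2 else 0) := by
  have habs : ∑ i ∈ range h, ∑ c ∈ range (h + 1),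
      (max (((i + 1 : ℕ) : ℚ) - c) (c - (i + 1 : ℕ)) + (d - b)) =
      h * (h + 1) * (2 * h + 1) / 6 + h * (h + 1) * (d - b) := by
    rw [sum_sum_range_succ_eq h (fun a c => max ((a : ℚ) - c) (c - a) + (d - b))]
    have h1 : ∀ i ∈ range h, (max (((i + 1 : ℕ) : ℚ) - (0 : ℕ)) ((0 : ℕ) - (i + 1 : ℕ)) + (d - b) +
        (max (((i + 1 : ℕ) : ℚ) - (i + 1 : ℕ)) ((i + 1 : ℕ) - (i + 1 : ℕ)) + (d - b))) =
        (1 + 2 * (d - b)) + (1 : ℚ) * i := by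
      intro i _
      have : (0 : ℚ) ≤ i := by positivity
      rw [max_eq_left (by push_cast; linarith), sub_self, max_self]
      push_cast
      ring
    have h2 : ∀ i ∈ range h, ∑ j ∈ range i,
        (max (((i + 1 : ℕ) : ℚ) - (j + 1 : ℕ)) ((j + 1 : ℕ) - (i + 1 : ℕ)) + (d - b) +
          (max (((j + 1 : ℕ) : ℚ) - (i + 1 : ℕ)) ((i + 1 : ℕ) - (j + 1 : ℕ)) + (d - b))) =
        ∑ j ∈ range i, (2 * ((d : ℚ) - b) + 2 * (i - j)) := by
      refine fun i _ => sum_congr rfl fun j hj => ?_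
      have : (j : ℚ) < i := by exact_mod_cast mem_range.mp hj
      rw [max_eq_left (by push_cast; linarith), max_eq_right (by push_cast; linarith)]
      push_cast
      ring
    rw [sum_congr rfl h1, sum_congr rfl h2, sum_range_affine, sum_sum_range_sub]
    ring
  have hone : ∀ (k : ℕ) (p : Prop) [Decidable p], 1 ≤ k → k ≤ h →
      ∑ i ∈ range h, ∑ c ∈ range (h + 1),
        (if ((i + 1 : ℕ) : ℤ) = k ∧ (c : ℤ) = k ∧ ¬ p then (2 : ℚ) else 0) =
      if p then 0 else 2 := by
    intro k p _ hk hkh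
    rw [sum_eq_single_of_mem (k - 1) (mem_range.mpr (by omega)),
      sum_eq_single_of_mem k (mem_range.mpr (by omega))]
    · rw [Nat.sub_add_cancel hk]
      by_cases hp : p <;> simp [hp]
    · intro c _ hc
      exact if_neg (by omega)
    · intro i _ hi
      refine sum_eq_zero fun c _ => if_neg (by omega)
  have h1 := hone 1 ((b : ℤ) % 2 = 0 ∧ (d : ℤ) = b + 1) le_rfl (by omega)
  have h2 := hone h ((b : ℤ) % 2 = 1 ∧ (d : ℤ) = b + 1) (by omega) le_rfl
  simp only [rightDist]
  push_cast at h1 h2 habs ⊢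
  simp only [sum_add_distrib] at habs ⊢
  rw [h1, h2, habs]
  split_ifs <;> first | omega | ring

theorem sum_combDist_of_gt (h n b d : ℕ) (hh : 3 ≤ h) (hdb : b < d) :
    ∑ i ∈ range h, ∑ c ∈ range (h + 1), (combDist h n (i + 1 : ℕ) b c d : ℚ) =
      h * (h + 1) * (2 * h + 1) / 6 + h * (h + 1) * (d - b) + 4 - (if d = b + 1 then 2 else 0) := by
  rw [← sum_rightDist h b d hh]
  refine sum_congr rfl fun i _ => sum_congr rfl fun c _ => ?_
  rw [combDist_of_gt (by omega) (by omega)]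

theorem sum_columnDist (h n b : ℕ) (hh : 3 ≤ h) (hb : b + 1 < n) :
    ∑ i ∈ range h, ∑ c ∈ range (h + 1), (columnDist h n (i + 1 : ℕ) b c : ℚ) =
      (h - 1) * h * (h + 1) / 6 + h * (h + 1) / 2 + (h - 1) * (1 - (-1) ^ b) + detourSum h +
        (if b = 0 then (h - 1) * h * (h + 1) / 2 - detourSum h else 0) := by
  rw [sum_sum_range_succ_eq h (fun a c => (columnDist h n a b c : ℚ))]
  rcases Nat.even_or_odd b with hb2 | hb2
  · have hb3 : (b : ℤ) % 2 = 0 := by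
      have := Nat.even_iff.mp hb2
      omega
    have h1 : ∀ i ∈ range h, ((columnDist h n (i + 1 : ℕ) b (0 : ℕ) : ℚ) +
        columnDist h n (i + 1 : ℕ) b (i + 1 : ℕ)) = 1 + 1 * i := by
      intro i _
      have h1 : columnDist h n (i + 1 : ℕ) b (0 : ℕ) = i + 1 := by
        simp only [columnDist]
        split_ifs <;> omega
      have h2 : columnDist h n (i + 1 : ℕ) b (i + 1 : ℕ) = 0 := by
        simp only [columnDist]
        split_ifs <;> omega
      rw [h1, h2]
      push_cast
      ring
    have h2 : ∀ i ∈ range h, ∑ j ∈ range i, ((columnDist h n (i + 1 : ℕ) b (j + 1 : ℕ) : ℚ) +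
        columnDist h n (j + 1 : ℕ) b (i + 1 : ℕ)) =
        ∑ j ∈ range i, ((0 + 1 * ((i : ℚ) - j)) +
          if b = 0 then 2 * (h : ℚ) - i - j else min ((i : ℚ) + j + 2) (2 * h - i - j)) := by
      refine fun i _ => sum_congr rfl fun j hj => ?_
      have := mem_range.mp hj
      have h1 : columnDist h n (i + 1 : ℕ) b (j + 1 : ℕ) = i - j := by
        simp only [columnDist]
        split_ifs <;> omega
      have h2 : columnDist h n (j + 1 : ℕ) b (i + 1 : ℕ) =
          if b = 0 then (2 * h - i - j : ℤ) else min (i + j + 2 : ℤ) (2 * h - i - j) := by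
        simp only [columnDist]
        split_ifs <;> omega
      rw [h1, h2]
      push_cast
      ring
    rw [sum_congr rfl h1, sum_congr rfl h2, sum_range_affine]
    simp only [sum_add_distrib (f := fun j : ℕ => (0 + 1 * ((_ : ℚ) - j)))]
    rw [sum_add_distrib, sum_sum_range_sub, hb2.neg_one_pow]
    by_cases hb0 : b = 0
    · simp only [if_pos hb0]
      have h3 : ∑ i ∈ range h, ∑ j ∈ range i, (2 * (h : ℚ) - i - j) = (h - 1) * h * (h + 1) / 2 := by
        have key : ∀ N : ℕ, ∑ i ∈ range N, ∑ j ∈ range i, (2 * (h : ℚ) - i - j) =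
            h * (N * (N - 1)) - N * (N - 1) ^ 2 / 2 := fun N => by
          induction N with
          | zero => simp
          | succ N ih =>
            have : ∀ j ∈ range N, (2 * (h : ℚ) - N - j) = (2 * h - N) + (-1) * j :=
              fun _ _ => by ring
            rw [sum_range_succ, ih, sum_congr rfl this, sum_range_affine]
            push_cast
            ring
        rw [key h]
        ring
      rw [h3]
      ring
    · simp only [if_neg hb0]
      rw [← detourSum]
      ring
  · have hb3 : (b : ℤ) % 2 = 1 := by
      have := Nat.odd_iff.mp hb2
      omega
    have h1 : ∀ i ∈ range h, ((columnDist h n (i + 1 : ℕ) b (0 : ℕ) : ℚ) +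
        columnDist h n (i + 1 : ℕ) b (i + 1 : ℕ)) =
          (3 + 1 * i) + if i = 0 then (-2 : ℚ) else 0 := by
      intro i _
      have h1 : columnDist h n (i + 1 : ℕ) b (0 : ℕ) = 3 + 1 * i + if i = 0 then (-2 : ℤ) else 0 := by
        simp only [columnDist]
        split_ifs <;> omega
      have h2 : columnDist h n (i + 1 : ℕ) b (i + 1 : ℕ) = 0 := by
        simp only [columnDist]
        split_ifs <;> omega
      rw [h1, h2]
      push_cast
      ring
    have h2 : ∀ i ∈ range h, ∑ j ∈ range i, ((columnDist h n (i + 1 : ℕ) b (j + 1 : ℕ) : ℚ) +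
        columnDist h n (j + 1 : ℕ) b (i + 1 : ℕ)) =
        ∑ j ∈ range i, ((0 + 1 * ((i : ℚ) - j)) + min ((i : ℚ) + j + 2) (2 * h - i - j)) := by
      refine fun i _ => sum_congr rfl fun j hj => ?_
      have := mem_range.mp hj
      have h1 : columnDist h n (j + 1 : ℕ) b (i + 1 : ℕ) = i - j := by
        simp only [columnDist]
        split_ifs <;> omega
      have h2 : columnDist h n (i + 1 : ℕ) b (j + 1 : ℕ) =
          min (i + j + 2 : ℤ) (2 * h - i - j) := by
        simp only [columnDist]
        split_ifs <;> omega
      rw [h1, h2]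
      push_cast
      ring
    have hb0 : b ≠ 0 := by omega
    rw [sum_congr rfl h1, sum_congr rfl h2, sum_add_distrib, sum_range_affine, sum_ite_eq' (range h) 0,
      if_pos (mem_range.mpr (by omega)), if_neg hb0]
    simp only [sum_add_distrib (f := fun j : ℕ => (0 + 1 * ((_ : ℚ) - j)))]
    rw [sum_add_distrib, sum_sum_range_sub, hb2.neg_one_pow, ← detourSum]
    ring

theorem sum_columnDist_last (h n b : ℕ) (hn : n % 2 = 0) (hb : b + 1 = n) :
    ∑ i ∈ range h, ∑ c ∈ range (h + 1), (columnDist h n (i + 1 : ℕ) b c : ℚ) =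
      2 * (h - 1) * h * (h + 1) / 3 + 3 * h * (h + 1) / 2 := by
  rw [sum_sum_range_succ_eq h (fun a c => (columnDist h n a b c : ℚ))]
  have h1 : ∀ i ∈ range h, ((columnDist h n (i + 1 : ℕ) b (0 : ℕ) : ℚ) +
      columnDist h n (i + 1 : ℕ) b (i + 1 : ℕ)) = (2 * h + 1) + (-1) * i := by
    intro i _
    have h1 : columnDist h n (i + 1 : ℕ) b (0 : ℕ) = (2 * h + 1) - i := by
      simp only [columnDist]
      split_ifs <;> omega
    have h2 : columnDist h n (i + 1 : ℕ) b (i + 1 : ℕ) = 0 := by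
      simp only [columnDist]
      split_ifs <;> omega
    rw [h1, h2]
    push_cast
    ring
  have h2 : ∀ i ∈ range h, ∑ j ∈ range i, ((columnDist h n (i + 1 : ℕ) b (j + 1 : ℕ) : ℚ) +
      columnDist h n (j + 1 : ℕ) b (i + 1 : ℕ)) =
      2 * (h : ℚ) * i + (-2) * (i * (i - 1) / 2) := by
    intro i _
    have : ∀ j ∈ range i, ((columnDist h n (i + 1 : ℕ) b (j + 1 : ℕ) : ℚ) +
        columnDist h n (j + 1 : ℕ) b (i + 1 : ℕ)) = 2 * h + (-2) * j := by
      intro j hj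
      have := mem_range.mp hj
      have h1 : columnDist h n (j + 1 : ℕ) b (i + 1 : ℕ) = i - j := by
        simp only [columnDist]
        split_ifs <;> omega
      have h2 : columnDist h n (i + 1 : ℕ) b (j + 1 : ℕ) = 2 * h - i - j := by
        simp only [columnDist]
        split_ifs <;> omega
      rw [h1, h2]
      push_cast
      ring
    rw [sum_congr rfl this, sum_range_affine]
    ring
  have h3 : ∀ N : ℕ, ∑ i ∈ range N, (2 * (h : ℚ) * i + (-2) * (i * (i - 1) / 2)) =
      h * (N * (N - 1)) - N * (N - 1) * (N - 2) / 3 := fun N => by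
    induction N with
    | zero => simp
    | succ N ih =>
      rw [sum_range_succ, ih]
      push_cast
      ring
  rw [sum_congr rfl h1, sum_congr rfl h2, sum_range_affine, h3]
  ring

/-- Sum of the distances from column `b` to column `d` in `C_{h+1,n}`. -/
def blockSum (h n b d : ℕ) : ℚ :=
  ∑ a ∈ range (h + 1), ∑ c ∈ range (h + 1), (combDist h n a b c d : ℚ)

theorem blockSum_eq (h n b d : ℕ) :
    blockSum h n b d = ∑ i ∈ range h, ∑ c ∈ range (h + 1), (combDist h n (i + 1 : ℕ) b c d : ℚ) +
      ∑ c ∈ range (h + 1), (topDist h n b c d : ℚ) := by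
  simp only [blockSum, sum_range_succ' _ h, Nat.cast_zero, combDist_top]

theorem blockSum_of_lt (h n b d : ℕ) (hd : d + 1 < n) (hdb : d < b) :
    blockSum h n b d =
      ((h + 1) ^ 2 * (n - b) + h * (h + 1) ^ 2 * (b - 1) + (h + 1) * (h ^ 2 + 1) / 2
        + h * (h + 1) ^ 2 / 2) + -(h * (h + 1) ^ 2) * d
        + (h + 1) * (h - 1) / 2 * (-1) ^ d := by
  rw [blockSum_eq, sum_combDist_of_lt h n b d hdb, sum_topDist_of_lt h n b d hd hdb]
  ring

theorem blockSum_of_gt (h n b d : ℕ) (hh : 3 ≤ h) (hd : d + 1 < n) (hbd : b < d) :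
    blockSum h n b d =
      (h * (h + 1) * n - h ^ 2 * (1 + d) + h * (h - 1) / 2 + d + h * (h + 1) * (2 * h + 1) / 6
        + h * (h + 1) * d + 4) + (h ^ 2 - 1 - 2 * (h * (h + 1))) * b
        - (if d = b + 1 then 2 else 0) := by
  rw [blockSum_eq, sum_combDist_of_gt h n b d hh hbd, sum_topDist_of_le h n b d hd hbd.le]
  ring

theorem blockSum_last (h n b d : ℕ) (hh : 3 ≤ h) (hd : d + 1 = n) (hbd : b < d) :
    blockSum h n b d =
      (h * (h + 1) / 2 + (h + 1) * d + h * (h + 1) * (2 * h + 1) / 6 + h * (h + 1) * d + 4)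
        + (-(h + 1) ^ 2) * b - (if d = b + 1 then 2 else 0) := by
  rw [blockSum_eq, sum_combDist_of_gt h n b d hh hbd, sum_topDist_last h n b d hd]
  ring

theorem blockSum_self (h n b : ℕ) (hh : 3 ≤ h) (hb : b + 1 < n) :
    blockSum h n b b =
      (h * (n * (h + 1) - h) + h * (h - 1) / 2 + (h - 1) * h * (h + 1) / 6 + h * (h + 1) / 2
        + (h - 1) + detourSum h) + -(h * (h + 1)) * b + -(h - 1) * (-1) ^ b
        + (if b = 0 then ((h : ℚ) - 1) * h * (h + 1) / 2 - detourSum h else 0) := by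
  have hself (i c : ℕ) : combDist h n (i + 1 : ℕ) b c b = columnDist h n (i + 1 : ℕ) b c :=
    combDist_self (by omega)
  simp only [blockSum_eq, hself]
  rw [sum_columnDist h n b hh hb, sum_topDist_of_le h n b b hb le_rfl]
  ring

theorem blockSum_self_last (h n b : ℕ) (hn : n % 2 = 0) (hb : b + 1 = n) :
    blockSum h n b b = 2 * (h - 1) * h * (h + 1) / 3 + 2 * h * (h + 1) := by
  have hself (i c : ℕ) : combDist h n (i + 1 : ℕ) b c b = columnDist h n (i + 1 : ℕ) b c :=
    combDist_self (by omega)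
  simp only [blockSum_eq, hself]
  rw [sum_columnDist_last h n b hn hb, sum_topDist_last h n b b hb]
  ring

theorem sum_range_affine_add_neg_one_pow (A B E : ℚ) (N : ℕ) :
    ∑ j ∈ range N, (A + B * j + E * (-1) ^ j - (if N = j + 1 then 2 else 0)) =
      N * A + B * (N * (N - 1) / 2) + E * ((1 - (-1) ^ N) / 2) - (if N = 0 then 0 else 2) := by
  have hE : ∑ j ∈ range N, E * (-1) ^ j = E * ((1 - (-1) ^ N) / 2) :=
    sum_range_induction _ (fun N : ℕ => E * ((1 - (-1) ^ N) / 2)) (by simp) N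
      (fun k _ => by ring)
  rw [sum_sub_distrib, sum_add_distrib, sum_range_affine, hE]
  congr 1
  cases N with
  | zero => simp
  | succ N =>
    simp only [Nat.add_right_cancel_iff, N.succ_ne_zero, if_false]
    rw [sum_ite_eq]
    simp

theorem sum_range_quadratic_add_neg_one_pow (P Q F K R S B E : ℚ) (N : ℕ) :
    ∑ i ∈ range (N + 1), (P + Q * i + F * (-1) ^ i + (if i = 0 then K else 0) +
        (i * (R + S * i) + B * (i * (i - 1) / 2) + E * ((1 - (-1) ^ i) / 2)
          - (if i = 0 then 0 else 2))) =
      (N + 1) * P + Q * (N * (N + 1) / 2) + F * ((1 + (-1) ^ N) / 2) + K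
        + R * (N * (N + 1) / 2) + S * (N * (N + 1) * (2 * N + 1) / 6)
        + B * ((N - 1) * N * (N + 1) / 6) + E * ((N + 1) / 2 - (1 + (-1) ^ N) / 4) - 2 * N := by
  induction N with
  | zero =>
    simp only [zero_add, sum_range_one, if_true, Nat.cast_zero, pow_zero]
    ring
  | succ N ih =>
    rw [sum_range_succ, ih, if_neg N.succ_ne_zero, if_neg N.succ_ne_zero]
    push_cast
    ring

theorem sum_blockSum (h N : ℕ) (hh : 3 ≤ h) (hN : Even N) :
    12 * ∑ b ∈ range (N + 2), ∑ d ∈ range (N + 2), blockSum h (N + 2 : ℕ) b d =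
      2 * ((h : ℚ) + 1) ^ 3 * (N + 2) ^ 3 + 2 * (h + 1) ^ 3 * (N + 2) ^ 2
        + 2 * (h + 1) ^ 3 * (N + 2) + 4 * (h + 1) ^ 3 + 4 * (h + 1) ^ 2 * (N + 2) ^ 3
        - 3 * (h + 1) ^ 2 * (N + 2) ^ 2 - (h + 1) ^ 2 * (N + 2) - 6 * (h + 1) ^ 2
        - 2 * (h + 1) * (N + 2) ^ 3 + 4 * (h + 1) * (N + 2) ^ 2 - 2 * (h + 1) * (N + 2)
        - 16 * (h + 1) + 24 * (N + 2) ^ 2 - 72 * (N + 2) + 72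
        + (1 + (-1) ^ h) / 2 * (3 * (N + 2) - 6) := by
  have hrow : ∀ i ∈ range (N + 1), blockSum h (N + 2) i i +
      ∑ j ∈ range i, (blockSum h (N + 2) i j + blockSum h (N + 2) j i) =
      (h * ((N + 2) * (h + 1) - h) + h * (h - 1) / 2 + (h - 1) * h * (h + 1) / 6
          + h * (h + 1) / 2 + (h - 1) + detourSum h) + -(h * (h + 1)) * i + -(h - 1) * (-1) ^ i
        + (if i = 0 then ((h : ℚ) - 1) * h * (h + 1) / 2 - detourSum h else 0)
        + (i * ((((h : ℚ) + 1) ^ 2 * (N + 2) - h * (h + 1) ^ 2 + (h + 1) * (h ^ 2 + 1) / 2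
            + h * (h + 1) ^ 2 / 2 + h * (h + 1) * (N + 2) - h ^ 2 + h * (h - 1) / 2
            + h * (h + 1) * (2 * h + 1) / 6 + 4)
          + (-(h + 1) ^ 2 + h * (h + 1) ^ 2 - h ^ 2 + 1 + h * (h + 1)) * i)
          + (h ^ 2 - 1 - 2 * (h * (h + 1)) - h * (h + 1) ^ 2) * (i * (i - 1) / 2)
          + (h + 1) * (h - 1) / 2 * ((1 - (-1) ^ i) / 2) - (if i = 0 then 0 else 2)) := by
    intro i hi
    have hiN := mem_range.mp hi
    have : ∀ j ∈ range i, blockSum h (N + 2) i j + blockSum h (N + 2) j i =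
        ((((h : ℚ) + 1) ^ 2 * (N + 2) - h * (h + 1) ^ 2 + (h + 1) * (h ^ 2 + 1) / 2
            + h * (h + 1) ^ 2 / 2 + h * (h + 1) * (N + 2) - h ^ 2 + h * (h - 1) / 2
            + h * (h + 1) * (2 * h + 1) / 6 + 4)
          + (-(h + 1) ^ 2 + h * (h + 1) ^ 2 - h ^ 2 + 1 + h * (h + 1)) * i)
          + (h ^ 2 - 1 - 2 * (h * (h + 1)) - h * (h + 1) ^ 2) * j
          + (h + 1) * (h - 1) / 2 * (-1) ^ j - (if i = j + 1 then 2 else 0) := by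
      intro j hj
      have hji := mem_range.mp hj
      rw [blockSum_of_lt h _ i j (by omega) hji, blockSum_of_gt h _ j i hh (by omega) hji]
      push_cast
      ring
    rw [sum_congr rfl this, sum_range_affine_add_neg_one_pow, blockSum_self h _ i hh (by omega)]
    push_cast
    ring
  have hlast : ∀ j ∈ range (N + 1),
      blockSum h (N + 2) (N + 1) j + blockSum h (N + 2) j (N + 1) =
        (((h : ℚ) + 1) ^ 2 + h * (h + 1) ^ 2 * N + (h + 1) * (h ^ 2 + 1) / 2
          + h * (h + 1) ^ 2 / 2 + h * (h + 1) / 2 + (h + 1) * (N + 1)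
          + h * (h + 1) * (2 * h + 1) / 6 + h * (h + 1) * (N + 1) + 4)
        + (-(h * (h + 1) ^ 2) + -(h + 1) ^ 2) * j
        + (h + 1) * (h - 1) / 2 * (-1) ^ j - (if N + 1 = j + 1 then 2 else 0) := by
    intro j hj
    have hjN := mem_range.mp hj
    rw [blockSum_of_lt h _ _ j (by omega) hjN, blockSum_last h _ j _ hh rfl hjN]
    push_cast
    ring
  rw [sum_sum_range_eq_triangle, sum_range_succ, sum_congr rfl hrow, sum_congr rfl hlast,
    sum_range_quadratic_add_neg_one_pow, sum_range_affine_add_neg_one_pow,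
    blockSum_self_last h _ _ (by have := Nat.even_iff.mp hN; omega) rfl,
    if_neg N.succ_ne_zero, detourSum_eq, pow_succ _ N, hN.neg_one_pow]
  push_cast
  ring

end Sums

theorem wiener_combArc {h n : ℕ} (hh : 3 ≤ h) (hn : Even n) :
    (wiener (CombArc (h + 1) n) : ℚ) =
      ∑ b ∈ Finset.range n, ∑ d ∈ Finset.range n, blockSum h n b d := by
  have hdist (x t : Fin (h + 1) × Fin n) : (ddist (CombArc (h + 1) n) x t : ℚ) =
      combDist h n (x.1 : ℕ) (x.2 : ℕ) (t.1 : ℕ) (t.2 : ℕ) := by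
    rw [← ddist_combArc hh hn, Int.cast_natCast]
  simp only [wiener, Nat.cast_sum, hdist, Fintype.sum_prod_type, blockSum, Finset.sum_range]
  rw [Finset.sum_comm]
  refine Finset.sum_congr rfl fun b _ => ?_
  conv_rhs => rw [Finset.sum_comm]
  exact Finset.sum_congr rfl fun a _ => Finset.sum_comm

/-- Theorem 2 (Wiener index of the comb orientation `C_{m,n}`), for even `n ≥ 4`
and `m ≥ 4`. -/
theorem wiener_comb (m n : ℕ) (hm : 4 ≤ m) (hn : 4 ≤ n) (hne : Even n) :
    (12 : ℤ) * (wiener (CombArc m n) : ℤ) =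
      2 * (m : ℤ) ^ 3 * (n : ℤ) ^ 3 + 2 * (m : ℤ) ^ 3 * (n : ℤ) ^ 2 + 2 * (m : ℤ) ^ 3 * (n : ℤ)
        + 4 * (m : ℤ) ^ 3 + 4 * (m : ℤ) ^ 2 * (n : ℤ) ^ 3 - 3 * (m : ℤ) ^ 2 * (n : ℤ) ^ 2
        - (m : ℤ) ^ 2 * (n : ℤ) - 6 * (m : ℤ) ^ 2 - 2 * (m : ℤ) * (n : ℤ) ^ 3
        + 4 * (m : ℤ) * (n : ℤ) ^ 2 - 2 * (m : ℤ) * (n : ℤ) - 16 * (m : ℤ)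
        + 24 * (n : ℤ) ^ 2 - 72 * (n : ℤ) + 72
        + (if Odd m then 3 * (n : ℤ) - 6 else 0) := by
  obtain ⟨h, rfl⟩ : ∃ h, m = h + 1 := ⟨m - 1, by omega⟩
  obtain ⟨N, rfl⟩ : ∃ N, n = N + 2 := ⟨n - 2, by omega⟩
  have hh : 3 ≤ h := by omega
  have hsum := sum_blockSum h N hh ((Nat.even_add.mp hne).mpr even_two)
  rw [← wiener_combArc hh hne] at hsum
  rw [← Int.cast_inj (α := ℚ)]
  rcases Nat.even_or_odd h with hpar | hpar
  · rw [hpar.neg_one_pow] at hsum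
    rw [if_pos hpar.add_one]
    push_cast
    linarith
  · rw [hpar.neg_one_pow] at hsum
    rw [if_neg (Nat.not_odd_iff_even.mpr hpar.add_one)]
    push_cast
    linarith
end

section
/- Let m ≥ 3 and let n be even with n ≥ 4. Then W(C_{m,n}) > W(D_{m,n}), i.e., the comb orientation of the grid G_{m,n} has strictly larger Wiener index than the orientation D_{m,n} (this disproves the conjecture of Kraner Šumenjak et al. that D_{m,n} maximizes the Wiener index among all orientations of G_{m,n}). -/
/-- The orientation `D_{m,n}` of the grid `G_{m,n}` (`0`-indexed: vertex `(a, b)`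
is the paper's vertex `(a+1, b+1)`, i.e. row `a+1` and column `b+1`). -/
def DArc (m n : ℕ) (p q : Fin m × Fin n) : Prop :=
  -- columns 1 … n−1 directed upward
  (p.2 = q.2 ∧ (p.2 : ℕ) + 2 ≤ n ∧ (p.1 : ℕ) = (q.1 : ℕ) + 1) ∨
  -- column n directed downward
  (p.2 = q.2 ∧ (p.2 : ℕ) + 1 = n ∧ (q.1 : ℕ) = (p.1 : ℕ) + 1) ∨
  -- row 1 directed rightward
  (p.1 = q.1 ∧ (p.1 : ℕ) = 0 ∧ (q.2 : ℕ) = (p.2 : ℕ) + 1) ∨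
  -- rows 2 … m directed leftward
  (p.1 = q.1 ∧ 1 ≤ (p.1 : ℕ) ∧ (p.2 : ℕ) = (q.2 : ℕ) + 1)

/-! ### Distances in a digraph -/

theorem exists_walk_of_reflTransGen {V : Type*} {A : V → V → Prop} {u v : V}
    (h : Relation.ReflTransGen A u v) :
    ∃ k, ∃ f : ℕ → V, f 0 = u ∧ f k = v ∧ ∀ i < k, A (f i) (f (i + 1)) := by
  induction h using Relation.ReflTransGen.head_induction_on with
  | refl => exact ⟨0, fun _ => v, rfl, rfl, by simp⟩
  | @head a _ hab _ ih =>
    obtain ⟨k, f, h0, hk, hf⟩ := ih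
    refine ⟨k + 1, fun i => Nat.casesOn i a f, rfl, hk, ?_⟩
    rintro (_ | i) hi
    · simpa [h0] using hab
    · exact hf i (by omega)

/-- A function that increases by at most one along arcs read backwards bounds distances below. -/
theorem sub_le_ddist {V : Type*} {A : V → V → Prop} {φ : V → ℤ}
    (hφ : ∀ p q, A p q → φ p ≤ φ q + 1) {u v : V} (h : Relation.ReflTransGen A u v) :
    φ u - φ v ≤ ddist A u v := by
  obtain ⟨f, h0, hk, hf⟩ := Nat.sInf_mem (exists_walk_of_reflTransGen h)
  change f (ddist A u v) = v at hk
  have key : ∀ i ≤ ddist A u v, φ u ≤ φ (f i) + i := by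
    intro i
    induction i with
    | zero => simp [h0]
    | succ i ih =>
      intro hi
      have h1 := ih (by omega)
      have h2 := hφ _ _ (hf i hi)
      push_cast
      linarith
  have := key _ le_rfl
  rw [hk] at this
  linarith

/-- If from every vertex other than `v` some arc decreases `F`, then `F` bounds the distance
to `v` above. -/
theorem ddist_le_of_descent {V : Type*} {A : V → V → Prop} {v : V} {F : V → ℕ}
    (h : ∀ u, u ≠ v → ∃ w, A u w ∧ F w < F u) (u : V) : ddist A u v ≤ F u := by
  suffices H : ∀ n u, F u = n →
      ∃ k ≤ n, ∃ f : ℕ → V, f 0 = u ∧ f k = v ∧ ∀ i < k, A (f i) (f (i + 1)) by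
    obtain ⟨k, hk, hf⟩ := H _ u rfl
    exact (Nat.sInf_le hf).trans hk
  intro n
  induction n using Nat.strong_induction_on with
  | _ n ih =>
    intro u hu
    by_cases huv : u = v
    · exact ⟨0, by omega, fun _ => v, huv.symm, rfl, by simp⟩
    · obtain ⟨w, hw, hlt⟩ := h u huv
      obtain ⟨k, hk, f, h0, hfk, hf⟩ := ih _ (hu ▸ hlt) w rfl
      refine ⟨k + 1, by omega, fun i => Nat.casesOn i u f, rfl, hfk, ?_⟩
      rintro (_ | i) hi
      · simpa [h0] using hw
      · exact hf i (by omega)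

theorem reflTransGen_of_descent {V : Type*} {A : V → V → Prop} {v : V} {F : V → ℕ}
    (h : ∀ u, u ≠ v → ∃ w, A u w ∧ F w < F u) (u : V) : Relation.ReflTransGen A u v := by
  induction hn : F u using Nat.strong_induction_on generalizing u with
  | _ n ih =>
    by_cases huv : u = v
    · rw [huv]
    · obtain ⟨w, hw, hlt⟩ := h u huv
      exact .head hw (ih _ (hn ▸ hlt) w rfl)

/-! ### Lower bounds for distances in the comb orientation -/

/-- Every vertex of the comb orientation reaches the top right corner. -/
theorem combArc_reaches_corner {M N : ℕ} (hM : 2 ≤ M) (hN : Odd N)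
    (u : Fin (M + 1) × Fin (N + 1)) :
    Relation.ReflTransGen (CombArc (M + 1) (N + 1)) u (0, Fin.last N) := by
  refine reflTransGen_of_descent (F := fun p => if (p.1 : ℕ) = 0 then N - p.2
    else if (p.2 : ℕ) % 2 = 0 then p.1 + N else 2 * M + 1 + N - p.1) ?_ u
  rintro ⟨⟨a, ha⟩, ⟨b, hb⟩⟩ hne
  rw [Nat.odd_iff] at hN
  have hne' : ¬ (a = 0 ∧ b = N) := by
    rintro ⟨rfl, rfl⟩; exact hne rfl
  by_cases ha0 : a = 0
  · refine ⟨(⟨a, ha⟩, ⟨b + 1, by omega⟩), .inl ⟨rfl, .inl ⟨ha0, rfl⟩⟩, ?_⟩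
    simp only [ha0, if_true]; omega
  by_cases hb2 : b % 2 = 0
  · refine ⟨(⟨a - 1, by omega⟩, ⟨b, hb⟩), ?_, ?_⟩
    · simp only [CombArc, Nat.even_iff, Nat.odd_iff, true_and]; right; omega
    · simp only [ha0, hb2, if_true, if_false]; split_ifs <;> omega
  by_cases haM : a = M
  · refine ⟨(⟨a, ha⟩, ⟨b - 1, by omega⟩), ?_, ?_⟩
    · simp only [CombArc, Nat.even_iff, Nat.odd_iff, true_and]; left; omega
    · simp only [ha0, hb2, if_false]; split_ifs <;> omega
  · refine ⟨(⟨a + 1, by omega⟩, ⟨b, hb⟩), ?_, ?_⟩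
    · simp only [CombArc, Nat.even_iff, Nat.odd_iff, true_and, and_true]; right; omega
    · simp only [ha0, hb2, if_false]; split_ifs <;> omega

/-- The top right corner of the comb orientation reaches every vertex. -/
theorem combArc_corner_reaches {M N : ℕ} (hM : 2 ≤ M) (hN : Odd N)
    (v : Fin (M + 1) × Fin (N + 1)) :
    Relation.ReflTransGen (CombArc (M + 1) (N + 1)) (0, Fin.last N) v := by
  rw [← Relation.reflTransGen_swap]
  refine reflTransGen_of_descent (F := fun p => (N - p.2) * (M + 3) +
    if (p.2 : ℕ) = N then p.1 else if (p.2 : ℕ) % 2 = 0 then M - p.1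
      else if (p.1 : ℕ) = 0 then 2 else p.1) ?_ v
  rintro ⟨⟨a, ha⟩, ⟨b, hb⟩⟩ hne
  rw [Nat.odd_iff] at hN
  have hne' : ¬ (a = 0 ∧ b = N) := by
    rintro ⟨rfl, rfl⟩; exact hne rfl
  have hstep : b < N → (N - b) * (M + 3) = (N - (b + 1)) * (M + 3) + (M + 3) := by
    intro h
    rw [← Nat.succ_mul]; congr 1; omega
  simp only [Function.swap]
  by_cases hbN : b = N
  · refine ⟨(⟨a - 1, by omega⟩, ⟨b, hb⟩), ?_, ?_⟩
    · simp only [CombArc, Nat.even_iff, Nat.odd_iff, true_and]; right; omega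
    · simp only [hbN, if_true]; omega
  have hs := hstep (by omega)
  by_cases hb2 : b % 2 = 0
  · by_cases haM : a = M
    · refine ⟨(⟨a, ha⟩, ⟨b + 1, by omega⟩), ?_, ?_⟩
      · simp only [CombArc, Nat.even_iff, Nat.odd_iff, true_and, and_true]; left; omega
      · simp only [hbN, hb2, if_true, if_false]; rw [hs]; split_ifs <;> omega
    · refine ⟨(⟨a + 1, by omega⟩, ⟨b, hb⟩), ?_, ?_⟩
      · simp only [CombArc, Nat.even_iff, Nat.odd_iff, true_and, and_true]; right; omega
      · simp only [hbN, hb2, if_true, if_false]; omega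
  by_cases ha1 : a = 1
  · refine ⟨(⟨a, ha⟩, ⟨b + 1, by omega⟩), ?_, ?_⟩
    · simp only [CombArc, Nat.even_iff, Nat.odd_iff, true_and, and_true]; left; omega
    · simp only [hbN, hb2, if_false]; rw [hs]; split_ifs <;> omega
  by_cases ha0 : a = 0
  · refine ⟨(⟨1, by omega⟩, ⟨b, hb⟩), ?_, ?_⟩
    · simp only [CombArc, Nat.even_iff, Nat.odd_iff, true_and]; right; omega
    · simp [hbN, hb2, ha0]
  · refine ⟨(⟨a - 1, by omega⟩, ⟨b, hb⟩), ?_, ?_⟩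
    · simp only [CombArc, Nat.even_iff, Nat.odd_iff, true_and]; right; omega
    · simp only [hbN, hb2, ha0, if_false]; split_ifs <;> omega

theorem combArc_reaches {M N : ℕ} (hM : 2 ≤ M) (hN : Odd N) (u v : Fin (M + 1) × Fin (N + 1)) :
    Relation.ReflTransGen (CombArc (M + 1) (N + 1)) u v :=
  (combArc_reaches_corner hM hN u).trans (combArc_corner_reaches hM hN v)

/-- Number of vertical steps between row `a` and the row (the last one if `j` is even, the second
one if `j` is odd) in which column `j` is entered from the right. -/
def gateDist (M j a : ℕ) : ℤ :=
  if j % 2 = 0 then M - a else ((a : ℤ) - 1).natAbs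

/-- A lower bound for the distance from `(a, b)` to `(c, d)` in the comb orientation with
`M + 1` rows and `N + 1` columns. -/
def combBound (M N a b c d : ℕ) : ℤ :=
  if a = 0 ∧ (c ≠ 0 ∨ d < b) then
    (N - b) + if d = N then (c : ℤ) else (N - d) * M + 1 + gateDist M d c
  else if d < b then
    (b - d) * M - (M - 1) + gateDist M (b + 1) a + gateDist M d c
  else if d = b ∧ (b % 2 = 0 ∧ a < c ∨ b = N ∧ c < a ∨ b % 2 = 1 ∧ 1 ≤ c ∧ c < a) then
    ((a : ℤ) - c).natAbs + 2
  else ((a : ℤ) - c).natAbs + (d - b)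

theorem combBound_self (M N c d : ℕ) : combBound M N c d c d = 0 := by
  simp [combBound]

theorem combBound_le_of_horizontal {M N a b b' c d : ℕ} (hM : 2 ≤ M) (hN : N % 2 = 1)
    (ha : a ≤ M) (hb : b ≤ N) (hb' : b' ≤ N) (hc : c ≤ M) (hd : d ≤ N)
    (h : (a ≠ 1 ∨ b % 2 = 0) ∧ (a ≠ M ∨ b % 2 = 1) ∧ b' = b + 1 ∨
      (a = 1 ∧ b' % 2 = 1 ∨ a = M ∧ b' % 2 = 0) ∧ b = b' + 1) :
    combBound M N a b c d ≤ combBound M N a b' c d + 1 := by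
  rcases h with ⟨h1, h2, rfl⟩ | ⟨h, rfl⟩
  · have hs : ((b + 1 : ℕ) - d : ℤ) * M = (b - d) * M + M := by push_cast; ring
    unfold combBound gateDist
    rw [hs]
    rcases lt_trichotomy d b with hdb | rfl | hdb
    · generalize ((b : ℤ) - d) * M = x
      generalize ((N : ℤ) - d) * M = y
      split_ifs <;> omega
    · simp only [sub_self, zero_mul]
      have : (d : ℤ) + 1 ≤ N := by exact_mod_cast hb'
      have : (M : ℤ) ≤ (N - d) * M := by nlinarith
      generalize ((N : ℤ) - d) * M = y at *
      split_ifs <;> omega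
    · generalize ((b : ℤ) - d) * M = x
      generalize ((N : ℤ) - d) * M = y
      split_ifs <;> omega
  · have ha0 : a ≠ 0 := by omega
    have hs : ((b' + 1 : ℕ) - d : ℤ) * M = (b' - d) * M + M := by push_cast; ring
    unfold combBound gateDist
    rw [hs]
    simp only [ha0, false_and, if_false]
    rcases lt_trichotomy d b' with hdb | rfl | hdb
    · generalize ((b' : ℤ) - d) * M = x
      split_ifs <;> omega
    · simp only [sub_self, zero_mul]
      split_ifs <;> omega
    · split_ifs <;> omega

theorem combBound_le_of_vertical {M N a a' b c d : ℕ} (hM : 2 ≤ M) (hN : N % 2 = 1)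
    (ha : a ≤ M) (_ha' : a' ≤ M) (hb : b ≤ N) (hc : c ≤ M) (hd : d ≤ N)
    (h : b % 2 = 0 ∧ a = a' + 1 ∨ b = N ∧ a' = a + 1 ∨ b < N ∧ a = 1 ∧ a' = 0 ∨
      b % 2 = 1 ∧ 1 ≤ a ∧ a' = a + 1) :
    combBound M N a b c d ≤ combBound M N a' b c d + 1 := by
  have hdN : d = N ∨ (M : ℤ) ≤ (N - d) * M ∧ 2 * ((N : ℤ) - d) ≤ (N - d) * M := by
    rcases hd.eq_or_lt with h | h
    · exact .inl h
    · have : (d : ℤ) + 1 ≤ N := by exact_mod_cast h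
      exact .inr ⟨by nlinarith, by nlinarith⟩
  have hbN : ((b : ℤ) - d) * M ≤ (N - d) * M := by gcongr
  unfold combBound gateDist
  by_cases hdb : d < b
  · by_cases ha0 : a = 0
    · obtain rfl : b = N := by omega
      generalize ((b : ℤ) - d) * M = x at *
      split_ifs <;> omega
    by_cases ha0' : a' = 0
    · have : (M : ℤ) + (b - d) * M ≤ (N - d) * M := by
        have : (b : ℤ) + 1 ≤ N := by omega
        nlinarith
      generalize ((b : ℤ) - d) * M = x at *
      generalize ((N : ℤ) - d) * M = y at *
      split_ifs <;> omega
    · simp only [ha0, ha0', false_and, if_false]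
      generalize ((b : ℤ) - d) * M = x at *
      split_ifs <;> omega
  · generalize ((N : ℤ) - d) * M = y at *
    simp only [hdb, or_false, if_false]
    split_ifs <;> omega

theorem combBound_le_of_combArc {M N : ℕ} (hM : 2 ≤ M) (hN : Odd N) {c d : ℕ} (hc : c ≤ M)
    (hd : d ≤ N) (p q : Fin (M + 1) × Fin (N + 1)) (h : CombArc (M + 1) (N + 1) p q) :
    combBound M N p.1 p.2 c d ≤ combBound M N q.1 q.2 c d + 1 := by
  obtain ⟨⟨a, ha⟩, ⟨b, hb⟩⟩ := p
  obtain ⟨⟨a', ha'⟩, ⟨b', hb'⟩⟩ := q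
  simp only [CombArc, Fin.mk.injEq, Nat.even_iff, Nat.odd_iff] at h ⊢
  rw [Nat.odd_iff] at hN
  rcases h with ⟨rfl, h⟩ | ⟨rfl, h⟩
  · exact combBound_le_of_horizontal hM hN (by omega) (by omega) (by omega) hc hd (by omega)
  · exact combBound_le_of_vertical hM hN (by omega) (by omega) (by omega) hc hd (by omega)

theorem combBound_le_ddist {M N : ℕ} (hM : 2 ≤ M) (hN : Odd N)
    (u v : Fin (M + 1) × Fin (N + 1)) :
    combBound M N u.1 u.2 v.1 v.2 ≤ ddist (CombArc (M + 1) (N + 1)) u v := by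
  have := sub_le_ddist (φ := fun p => combBound M N p.1 p.2 v.1 v.2)
    (combBound_le_of_combArc hM hN (Nat.lt_succ_iff.mp v.1.2) (Nat.lt_succ_iff.mp v.2.2))
    (combArc_reaches hM hN u v)
  simpa [combBound_self] using this

/-! ### Upper bounds for distances in the orientation `D` -/

/-- An upper bound for the distance from `(a, b)` to `(c, d)` in the orientation `D` with
`M + 1` rows and `N + 1` columns. -/
def dBound (N a b c d : ℕ) : ℤ :=
  if c = 0 then
    if a = 0 then if b ≤ d then (d : ℤ) - b else 2 * N - b - d + 2
    else if b = N ∧ d = N then (a : ℤ) + 2 else a + ((b : ℤ) - d).natAbs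
  else if b = N then
    if d = N ∧ c < a then (a : ℤ) + c + 2 else ((a : ℤ) - c).natAbs + (N - d)
  else if c ≤ a ∧ d ≤ b then (a : ℤ) - c + (b - d)
  else a + c + 2 * N - b - d

theorem ddist_le_dBound {M N : ℕ} (hN : 1 ≤ N) (hM : 1 ≤ M)
    (u v : Fin (M + 1) × Fin (N + 1)) :
    (ddist (DArc (M + 1) (N + 1)) u v : ℤ) ≤ dBound N u.1 u.2 v.1 v.2 := by
  have nonneg : ∀ p : Fin (M + 1) × Fin (N + 1), 0 ≤ dBound N p.1 p.2 v.1 v.2 := by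
    intro p
    have h1 := p.2.2
    have h2 := v.2.2
    unfold dBound
    split_ifs <;> omega
  rw [← Int.toNat_of_nonneg (nonneg u), Int.ofNat_le]
  refine ddist_le_of_descent (F := fun p => (dBound N p.1 p.2 v.1 v.2).toNat) ?_ u
  intro p hpv
  suffices H : ∃ w, DArc (M + 1) (N + 1) p w ∧
      dBound N w.1 w.2 v.1 v.2 < dBound N p.1 p.2 v.1 v.2 by
    obtain ⟨w, hw, hlt⟩ := H
    exact ⟨w, hw, by have := nonneg w; omega⟩
  clear nonneg
  obtain ⟨⟨a, ha⟩, ⟨b, hb⟩⟩ := p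
  obtain ⟨⟨c, hc⟩, ⟨d, hd⟩⟩ := v
  have hne : ¬ (a = c ∧ b = d) := by
    rintro ⟨rfl, rfl⟩; exact hpv rfl
  have right : a = 0 → ∀ h : b < N, DArc (M + 1) (N + 1) (⟨a, ha⟩, ⟨b, hb⟩)
      (⟨a, ha⟩, ⟨b + 1, by omega⟩) := fun h0 _ => .inr (.inr (.inl ⟨rfl, h0, rfl⟩))
  have left : 1 ≤ a → ∀ h : 1 ≤ b, DArc (M + 1) (N + 1) (⟨a, ha⟩, ⟨b, hb⟩)
      (⟨a, ha⟩, ⟨b - 1, by omega⟩) := fun h0 h =>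
    .inr (.inr (.inr ⟨rfl, h0, (Nat.sub_add_cancel h).symm⟩))
  have down : b = N → ∀ h : a < M, DArc (M + 1) (N + 1) (⟨a, ha⟩, ⟨b, hb⟩)
      (⟨a + 1, by omega⟩, ⟨b, hb⟩) := fun h0 _ =>
    .inr (.inl ⟨rfl, congrArg (· + 1) h0, rfl⟩)
  have up : b < N → ∀ h : 1 ≤ a, DArc (M + 1) (N + 1) (⟨a, ha⟩, ⟨b, hb⟩)
      (⟨a - 1, by omega⟩, ⟨b, hb⟩) := fun h0 h =>
    .inl ⟨rfl, by simp only; omega, (Nat.sub_add_cancel h).symm⟩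
  by_cases hbN : b = N
  · by_cases hac : a < c ∨ a = 0
    · refine ⟨_, down hbN (by omega), ?_⟩
      simp only [dBound, Nat.add_one_ne_zero, if_false]; split_ifs <;> omega
    · refine ⟨_, left (by omega) (by omega), ?_⟩
      simp only [dBound]; split_ifs <;> omega
  by_cases ha0 : a = 0
  · refine ⟨_, right ha0 (by omega), ?_⟩
    simp only [dBound]; split_ifs <;> omega
  by_cases hdb : d < b ∧ c ≤ a
  · refine ⟨_, left (by omega) (by omega), ?_⟩
    simp only [dBound]; split_ifs <;> omega
  · refine ⟨_, up (by omega) (by omega), ?_⟩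
    simp only [dBound]; split_ifs <;> omega

/-! ### Summation of the bounds -/

open Finset in
theorem sum_range_cast (n : ℕ) : ∑ i ∈ range n, (i : ℚ) = n * (n - 1) / 2 :=
  sum_range_induction _ (fun n : ℕ => (n : ℚ) * (n - 1) / 2) (by simp) n
    fun i _ => by push_cast; ring

open Finset in
theorem sum_square_succ (f : ℕ → ℕ → ℚ) (n : ℕ) :
    ∑ i ∈ range (n + 1), ∑ j ∈ range (n + 1), f i j =
      ∑ i ∈ range n, ∑ j ∈ range n, f i j + ∑ j ∈ range n, (f n j + f j n) + f n n := by
  simp only [sum_range_succ, sum_add_distrib]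
  ring

open Finset in
theorem sum_square_eq_of_step {f : ℕ → ℕ → ℚ} {s : ℕ → ℚ} (n : ℕ) (h0 : s 0 = 0)
    (h : ∀ i < n, s (i + 1) = s i + (∑ j ∈ range i, (f i j + f j i) + f i i)) :
    ∑ i ∈ range n, ∑ j ∈ range n, f i j = s n := by
  induction n with
  | zero => simp [h0]
  | succ n ih =>
    rw [sum_square_succ, ih fun i hi => h i (by omega), h n (by omega), add_assoc]

open Finset in
/-- Sum over a square of a function whose symmetrization is affine off the diagonal, up to a
multiple of a function `g` of the smaller index, and affine on the diagonal. -/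
theorem sum_square_of_affine {f : ℕ → ℕ → ℚ} {g : ℕ → ℚ} {p q α β γ δ : ℚ} (n : ℕ)
    (hdiag : ∀ i < n, f i i = p + q * i)
    (hoff : ∀ i < n, ∀ j < i, f i j + f j i = α + β * i + γ * j + δ * g j) :
    ∑ i ∈ range n, ∑ j ∈ range n, f i j =
      p * n + (q + α) * (n * (n - 1) / 2) + β * (n * (n - 1) * (2 * n - 1) / 6)
        + γ * (n * (n - 1) * (n - 2) / 6) + δ * ∑ i ∈ range n, ∑ j ∈ range i, g j := by
  refine sum_square_eq_of_step (s := fun n => p * n + (q + α) * (n * (n - 1) / 2)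
    + β * (n * (n - 1) * (2 * n - 1) / 6) + γ * (n * (n - 1) * (n - 2) / 6)
    + δ * ∑ i ∈ range n, ∑ j ∈ range i, g j) n (by simp) fun i hi => ?_
  rw [hdiag i hi, sum_congr rfl fun j hj => hoff i hi j (mem_range.mp hj), sum_range_succ]
  simp only [sum_add_distrib, ← mul_sum, sum_const, card_range, nsmul_eq_mul, sum_range_cast]
  push_cast
  ring

open Finset in
theorem sum_rows_split (f : ℕ → ℕ → ℚ) (M : ℕ) :
    ∑ a ∈ range (M + 1), ∑ c ∈ range (M + 1), f a c =
      ∑ a ∈ range M, ∑ c ∈ range M, f (a + 1) (c + 1) + ∑ a ∈ range M, f (a + 1) 0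
        + ∑ c ∈ range M, f 0 (c + 1) + f 0 0 := by
  simp only [sum_range_succ', sum_add_distrib]
  ring

open Finset in
/-- The sum of `F` over all pairs of a vertex of column `b` and a vertex of column `d`. -/
def columnSum (M : ℕ) (F : ℕ → ℕ → ℕ → ℕ → ℤ) (b d : ℕ) : ℚ :=
  ∑ a ∈ range (M + 1), ∑ c ∈ range (M + 1), (F a b c d : ℚ)

open Finset in
theorem sum_gateDist (M j : ℕ) :
    ∑ a ∈ range M, (gateDist M j (a + 1) : ℚ) = M * (M - 1) / 2 := by
  unfold gateDist
  rcases Nat.mod_two_eq_zero_or_one j with h | h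
  · simp only [h, if_true]
    push_cast
    simp only [sum_sub_distrib, sum_add_distrib, sum_const, card_range, nsmul_eq_mul,
      sum_range_cast]
    ring
  · simp [h, sum_range_cast]

/-! #### The comb orientation -/

open Finset in
theorem columnSum_combBound_of_lt {M N b d : ℕ} (hdb : d < b) (hb : b ≤ N) :
    columnSum M (combBound M N) b d = M ^ 3 * (b - d)
      + (M * ((b - d) * M - (M - 1) + gateDist M d 0) + M * (M - 1) / 2)
      + (M * ((N - b) + (N - d) * M + 1) + M * (M - 1) / 2)
      + ((N - b) + (N - d) * M + 1 + gateDist M d 0) := by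
  have hdN : d ≠ N := by omega
  have hpos : ∀ a c : ℕ, combBound M N (a + 1) b c d =
      (b - d) * M - (M - 1) + gateDist M (b + 1) (a + 1) + gateDist M d c := by
    intro a c; simp [combBound, hdb]
  have hzero : ∀ c : ℕ, combBound M N 0 b c d = (N - b) + ((N - d) * M + 1 + gateDist M d c) := by
    intro c; simp [combBound, hdb, hdN]
  rw [columnSum, sum_rows_split]
  simp only [hpos, hzero]
  push_cast
  simp only [sum_sub_distrib, sum_add_distrib, sum_const, card_range, nsmul_eq_mul, ← mul_sum,
    sum_gateDist]
  ring

open Finset in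
theorem sum_square_natAbs (M : ℕ) (x : ℚ) :
    ∑ a ∈ range M, ∑ c ∈ range M, (((((a + 1 : ℕ) : ℤ) - (c + 1 : ℕ)).natAbs : ℚ) + x) =
      (M ^ 3 - M) / 3 + M ^ 2 * x := by
  rw [sum_square_of_affine (p := x) (q := 0) (α := 2 * x) (β := 2) (γ := -2) (δ := 0) (g := 0)]
  · ring
  · intro i _
    simp
  · intro i _ j hj
    have h1 : (((i + 1 : ℕ) : ℤ) - (j + 1 : ℕ)).natAbs = i - j := by omega
    have h2 : (((j + 1 : ℕ) : ℤ) - (i + 1 : ℕ)).natAbs = i - j := by omega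
    rw [h1, h2, Nat.cast_sub hj.le]
    simp only [Pi.zero_apply]
    ring

open Finset in
theorem columnSum_combBound_of_gt {M N b d : ℕ} (hbd : b < d) (hd : d < N) :
    columnSum M (combBound M N) b d = (M ^ 3 - M) / 3 + M ^ 2 * (d - b)
      + (M * (M + 1) / 2 + M * (d - b))
      + (M * ((N - b) + (N - d) * M + 1) + M * (M - 1) / 2) + (d - b) := by
  have hpos : ∀ a c : ℕ, combBound M N (a + 1) b c d =
      (((a + 1 : ℕ) : ℤ) - c).natAbs + (d - b) := by
    intro a c; simp [combBound, hbd.not_gt, hbd.ne']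
  have hzero : ∀ c : ℕ, combBound M N 0 b (c + 1) d =
      (N - b) + ((N - d) * M + 1 + gateDist M d (c + 1)) := by
    intro c; simp [combBound, hd.ne]
  have hzz : combBound M N 0 b 0 d = d - b := by
    simp [combBound, hbd.not_gt]
  rw [columnSum, sum_rows_split]
  simp only [hpos, hzero, hzz, Int.cast_add, Int.cast_natCast, sum_square_natAbs, Int.cast_sub,
    Nat.cast_zero, sub_zero, Int.natAbs_natCast]
  push_cast
  simp only [sum_sub_distrib, sum_add_distrib, sum_const, card_range, nsmul_eq_mul, sum_gateDist,
    sum_range_cast]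
  ring

open Finset in
theorem columnSum_combBound_last {M N b : ℕ} (hb : b < N) :
    columnSum M (combBound M N) b N = (M ^ 3 - M) / 3 + M ^ 2 * (N - b)
      + (M * (M + 1) / 2 + M * (N - b)) + (M * (N - b) + M * (M + 1) / 2) + (N - b) := by
  have hpos : ∀ a c : ℕ, combBound M N (a + 1) b c N =
      (((a + 1 : ℕ) : ℤ) - c).natAbs + (N - b) := by
    intro a c; simp [combBound, hb.not_gt, hb.ne']
  have hzero : ∀ c : ℕ, combBound M N 0 b (c + 1) N = (N - b) + (c + 1 : ℕ) := by
    intro c; simp [combBound]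
  have hzz : combBound M N 0 b 0 N = N - b := by
    simp [combBound, hb.not_gt]
  rw [columnSum, sum_rows_split]
  simp only [hpos, hzero, hzz, Int.cast_add, Int.cast_natCast, sum_square_natAbs, Int.cast_sub,
    Nat.cast_zero, sub_zero, Int.natAbs_natCast]
  push_cast
  simp only [sum_sub_distrib, sum_add_distrib, sum_const, card_range, nsmul_eq_mul,
    sum_range_cast]
  ring

open Finset in
theorem sum_square_combBound_same_column {M N b : ℕ} (hb : b = N → b % 2 = 1) :
    ∑ a ∈ range M, ∑ c ∈ range M, (combBound M N (a + 1) b (c + 1) b : ℚ) =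
      (M ^ 3 - M) / 3 + M * (M - 1) := by
  rw [sum_square_of_affine (p := 0) (q := 0) (α := 2) (β := 2) (γ := -2) (δ := 0) (g := 0)]
  · ring
  · intro i _
    simp [combBound]
  · intro i _ j hj
    have h : combBound M N (i + 1) b (j + 1) b + combBound M N (j + 1) b (i + 1) b =
        2 + 2 * i - 2 * j := by
      rcases Nat.mod_two_eq_zero_or_one b with h | h
      · rw [combBound, if_neg (by omega), if_neg (by omega), if_neg (by omega),
          combBound, if_neg (by omega), if_neg (by omega), if_pos (by omega)]
        omega
      · rw [combBound, if_neg (by omega), if_neg (by omega), if_pos (by omega),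
          combBound, if_neg (by omega), if_neg (by omega), if_neg (by omega)]
        omega
    simp only [Pi.zero_apply]
    have h' := congrArg (Int.cast : ℤ → ℚ) h
    push_cast at h'
    linarith

open Finset in
theorem columnSum_combBound_diag {M N b : ℕ} (hb : b < N) :
    columnSum M (combBound M N) b b = (M ^ 3 - M) / 3 + M * (M - 1) + M * (M + 1) / 2
      + (M * ((N - b) + (N - b) * M + 1) + M * (M - 1) / 2) := by
  have hcol : ∀ a : ℕ, combBound M N (a + 1) b 0 b = (a + 1 : ℕ) := by
    intro a
    simp only [combBound, Nat.add_one_ne_zero, false_and, lt_irrefl, if_false, true_and]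
    split_ifs <;> omega
  have hzero : ∀ c : ℕ, combBound M N 0 b (c + 1) b =
      (N - b) + ((N - b) * M + 1 + gateDist M b (c + 1)) := by
    intro c; simp [combBound, hb.ne]
  rw [columnSum, sum_rows_split, sum_square_combBound_same_column (by omega)]
  simp only [hcol, hzero, combBound_self]
  push_cast
  simp only [sum_sub_distrib, sum_add_distrib, sum_const, card_range, nsmul_eq_mul, sum_gateDist,
    sum_range_cast]
  ring

open Finset in
theorem columnSum_combBound_diag_last {M N : ℕ} (hN : N % 2 = 1) :
    columnSum M (combBound M N) N N = (M ^ 3 - M) / 3 + M * (M - 1)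
      + (M * (M + 1) / 2 + 2 * M) + M * (M + 1) / 2 := by
  have hcol : ∀ a : ℕ, combBound M N (a + 1) N 0 N = (a + 1 : ℕ) + 2 := by
    intro a
    simp only [combBound, Nat.add_one_ne_zero, false_and, lt_irrefl, if_false, true_and]
    split_ifs <;> omega
  have hzero : ∀ c : ℕ, combBound M N 0 N (c + 1) N = (c + 1 : ℕ) := by
    intro c; simp [combBound]
  rw [columnSum, sum_rows_split, sum_square_combBound_same_column fun _ => hN]
  simp only [hcol, hzero, combBound_self]
  push_cast
  simp only [sum_add_distrib, sum_const, card_range, nsmul_eq_mul, sum_range_cast]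
  ring

open Finset in
theorem sum_gateDist_zero (M k : ℕ) :
    ∑ j ∈ range (2 * k + 1), (gateDist M j 0 : ℚ) = (k + 1) * M + k := by
  induction k with
  | zero => simp [gateDist]
  | succ k ih =>
    rw [show 2 * (k + 1) + 1 = 2 * k + 1 + 1 + 1 by ring, sum_range_succ, sum_range_succ, ih]
    have h1 : (2 * k + 1) % 2 = 1 := by omega
    have h2 : (2 * k + 1 + 1) % 2 = 0 := by omega
    simp only [gateDist, h1, h2]
    push_cast
    norm_num
    ring

open Finset in
theorem sum_sum_gateDist_zero (M k : ℕ) :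
    ∑ i ∈ range (2 * k + 1), ∑ j ∈ range i, (gateDist M j 0 : ℚ) = k * (k + 1) * M + k ^ 2 := by
  induction k with
  | zero => simp
  | succ k ih =>
    rw [show 2 * (k + 1) + 1 = 2 * k + 1 + 1 + 1 by ring, sum_range_succ, sum_range_succ, ih,
      sum_range_succ _ (2 * k + 1), sum_gateDist_zero]
    have h1 : (2 * k + 1) % 2 = 1 := by omega
    simp only [gateDist, h1]
    push_cast
    ring

/-! #### The orientation `D` -/

open Finset in
theorem columnSum_dBound_of_le {M N b d : ℕ} (hdb : d ≤ b) (hb : b < N) :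
    columnSum M (dBound N) b d = (M ^ 3 - M) / 6 + M * (M + 1) / 2 * (b - d)
      + M * (M + 1) * (M - 1) / 2 + M * (M - 1) / 2 * (2 * N - b - d)
      + (M * (M + 1) / 2 + M * (b - d)) + (M * (M + 1) / 2 + M * (2 * N - b - d))
      + (if b = d then 0 else 2 * N - b - d + 2 : ℚ) := by
  have hcol : ∀ a : ℕ, dBound N (a + 1) b 0 d = (a + 1 : ℕ) + (b - d) := by
    intro a
    simp only [dBound, Nat.add_one_ne_zero, if_true, if_false, hb.ne, false_and]
    omega
  have hzero : ∀ c : ℕ, dBound N 0 b (c + 1) d = (c + 1 : ℕ) + 2 * N - b - d := by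
    intro c; simp [dBound, hb.ne]
  have hzz : dBound N 0 b 0 d = if b = d then 0 else 2 * (N : ℤ) - b - d + 2 := by
    simp only [dBound, if_true]
    split_ifs <;> omega
  have hpos : ∑ a ∈ range M, ∑ c ∈ range M, (dBound N (a + 1) b (c + 1) d : ℚ) =
      (M ^ 3 - M) / 6 + M * (M + 1) / 2 * (b - d)
      + M * (M + 1) * (M - 1) / 2 + M * (M - 1) / 2 * (2 * N - b - d) := by
    rw [sum_square_of_affine (p := b - d) (q := 0) (α := 2 * N - 2 * d + 2) (β := 2) (γ := 0)
      (δ := 0) (g := 0)]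
    · ring
    · intro i _
      simp [dBound, hb.ne, hdb]
    · intro i _ j hj
      simp [dBound, hb.ne, hdb, hj.le, hj.not_ge]
      ring
  rw [columnSum, sum_rows_split, hpos]
  simp only [hcol, hzero, hzz]
  push_cast
  simp only [sum_sub_distrib, sum_add_distrib, sum_const, card_range, nsmul_eq_mul,
    sum_range_cast]
  ring

open Finset in
theorem columnSum_dBound_of_gt {M N b d : ℕ} (hbd : b < d) (hd : d ≤ N) :
    columnSum M (dBound N) b d = M ^ 2 * (M + 1) + M ^ 2 * (2 * N - b - d)
      + (M * (M + 1) / 2 + M * (d - b)) + (M * (M + 1) / 2 + M * (2 * N - b - d)) + (d - b) := by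
  have hbN : b ≠ N := by omega
  have hcol : ∀ a : ℕ, dBound N (a + 1) b 0 d = (a + 1 : ℕ) + (d - b) := by
    intro a
    simp only [dBound, Nat.add_one_ne_zero, if_true, if_false, hbN, false_and]
    omega
  have hrow : ∀ a c : ℕ, dBound N a b (c + 1) d = a + (c + 1 : ℕ) + 2 * N - b - d := by
    intro a c; simp [dBound, hbN, hbd.not_ge]
  have hzz : dBound N 0 b 0 d = d - b := by
    simp [dBound, hbd.le]
  rw [columnSum, sum_rows_split]
  simp only [hcol, hrow, hzz]
  push_cast
  simp only [sum_sub_distrib, sum_add_distrib, sum_const, card_range, nsmul_eq_mul,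
    ← mul_sum, sum_range_cast]
  ring

open Finset in
theorem columnSum_dBound_last {M N d : ℕ} (hd : d < N) :
    columnSum M (dBound N) N d = (M ^ 3 - M) / 3 + M ^ 2 * (N - d)
      + (M * (M + 1) / 2 + M * (N - d)) + (M * (M + 1) / 2 + M * (N - d)) + (N - d + 2) := by
  have hcol : ∀ a : ℕ, dBound N (a + 1) N 0 d = (a + 1 : ℕ) + (N - d) := by
    intro a
    simp only [dBound, Nat.add_one_ne_zero, if_true, if_false, hd.ne, and_false]
    omega
  have hrow : ∀ a c : ℕ, dBound N a N (c + 1) d = ((a : ℤ) - (c + 1 : ℕ)).natAbs + (N - d) := by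
    intro a c; simp [dBound, hd.ne]
  have hzero : ∀ c : ℕ, dBound N 0 N (c + 1) d = (c + 1 : ℕ) + (N - d) := by
    intro c; rw [hrow]; omega
  have hzz : dBound N 0 N 0 d = N - d + 2 := by
    simp only [dBound, if_true, hd.not_ge, if_false]; ring
  rw [columnSum, sum_rows_split]
  simp only [hcol, hzero, hzz, hrow, Int.cast_add, Int.cast_natCast, sum_square_natAbs,
    Int.cast_sub]
  push_cast
  simp only [sum_sub_distrib, sum_add_distrib, sum_const, card_range, nsmul_eq_mul,
    sum_range_cast]
  ring

open Finset in
theorem columnSum_dBound_diag_last (M N : ℕ) :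
    columnSum M (dBound N) N N = (M ^ 3 - M) / 6 + M * (M + 1) * (M - 1) / 2 + M * (M - 1)
      + (M * (M + 1) / 2 + 2 * M) + M * (M + 1) / 2 := by
  have hcol : ∀ a : ℕ, dBound N (a + 1) N 0 N = (a + 1 : ℕ) + 2 := by
    intro a; simp [dBound]
  have hzero : ∀ c : ℕ, dBound N 0 N (c + 1) N = (c + 1 : ℕ) := by
    intro c
    rw [dBound, if_neg (by omega), if_pos rfl, if_neg (by omega)]
    omega
  have hzz : dBound N 0 N 0 N = 0 := by simp [dBound]
  have hpos : ∑ a ∈ range M, ∑ c ∈ range M, (dBound N (a + 1) N (c + 1) N : ℚ) =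
      (M ^ 3 - M) / 6 + M * (M + 1) * (M - 1) / 2 + M * (M - 1) := by
    rw [sum_square_of_affine (p := 0) (q := 0) (α := 4) (β := 2) (γ := 0) (δ := 0) (g := 0)]
    · ring
    · intro i _
      simp [dBound]
    · intro i _ j hj
      have h1 : dBound N (i + 1) N (j + 1) N = i + j + 4 := by
        simp [dBound, hj]; ring
      have h2 : dBound N (j + 1) N (i + 1) N = i - j := by
        rw [dBound, if_neg (by omega), if_pos rfl, if_neg (by omega)]
        omega
      rw [h1, h2]
      push_cast
      simp only [Pi.zero_apply]
      ring
  rw [columnSum, sum_rows_split, hpos]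
  simp only [hcol, hzero, hzz]
  push_cast
  simp only [sum_add_distrib, sum_const, card_range, nsmul_eq_mul, sum_range_cast]
  ring

/-! ### Comparison -/

open Finset in
theorem sum_vertices_eq_columnSum (M N : ℕ) (F : ℕ → ℕ → ℕ → ℕ → ℤ) :
    ((∑ u : Fin (M + 1) × Fin (N + 1), ∑ v : Fin (M + 1) × Fin (N + 1),
      F u.1 u.2 v.1 v.2 : ℤ) : ℚ) =
      ∑ b ∈ range (N + 1), ∑ d ∈ range (N + 1), columnSum M F b d := by
  simp only [Fintype.sum_prod_type_right, columnSum, Int.cast_sum, ← Fin.sum_univ_eq_sum_range]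
  refine sum_congr rfl fun b _ => ?_
  rw [sum_comm]

open Finset in
theorem sum_columnSum_combBound (M k : ℕ) :
    ∑ b ∈ range (2 * k + 1 + 1), ∑ d ∈ range (2 * k + 1 + 1),
      columnSum M (combBound M (2 * k + 1)) b d =
        (6 + 25 * k + 27 * k ^ 2 + 8 * k ^ 3 + (24 + 70 * k + 76 * k ^ 2 + 24 * k ^ 3) * M
          + (30 + 73 * k + 63 * k ^ 2 + 20 * k ^ 3) * M ^ 2
          + (6 + 16 * k + 14 * k ^ 2 + 4 * k ^ 3) * M ^ 3) / 3 := by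
  obtain ⟨N, hN⟩ : ∃ N, N = 2 * k + 1 := ⟨_, rfl⟩
  have hlast : ∀ j ∈ range N, columnSum M (combBound M N) N j + columnSum M (combBound M N) j N =
      1 + 5 * M / 3 + 3 * M * N + M ^ 2 + 3 * M ^ 2 * N + M ^ 3 / 3 + M ^ 3 * N + N
        - (1 + 3 * M + 3 * M ^ 2 + M ^ 3) * j + (M + 1) * gateDist M j 0 := by
    intro j hj
    rw [mem_range] at hj
    rw [columnSum_combBound_of_lt hj le_rfl, columnSum_combBound_last hj]
    ring
  rw [← hN, sum_square_succ, columnSum_combBound_diag_last (by omega), sum_congr rfl hlast,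
    sum_square_of_affine (p := -M / 3 + M * N + 2 * M ^ 2 + M ^ 2 * N + M ^ 3 / 3)
      (q := -(M + M ^ 2))
      (α := 1 + 5 * M / 3 + 3 * M * N + M ^ 2 + 2 * M ^ 2 * N + M ^ 3 / 3 + N)
      (β := M ^ 2 + M ^ 3) (γ := -(1 + 3 * M + 3 * M ^ 2 + M ^ 3)) (δ := M + 1)
      (g := fun j => gateDist M j 0)]
  · simp only [sum_add_distrib, sum_sub_distrib, ← mul_sum, sum_const, card_range, nsmul_eq_mul,
      sum_range_cast]
    rw [hN, sum_gateDist_zero, sum_sum_gateDist_zero]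
    push_cast
    ring
  · intro i hi
    rw [columnSum_combBound_diag hi]
    ring
  · intro i hi j hj
    rw [columnSum_combBound_of_lt hj hi.le, columnSum_combBound_of_gt hj hi]
    ring

open Finset in
theorem sum_columnSum_dBound (M N : ℕ) :
    ∑ b ∈ range (N + 1), ∑ d ∈ range (N + 1), columnSum M (dBound N) b d =
      (8 * N + 12 * N ^ 2 + 4 * N ^ 3 + (8 + 16 * N + 19 * N ^ 2 + 7 * N ^ 3) * M
        + (12 + 19 * N + 18 * N ^ 2 + 5 * N ^ 3) * M ^ 2 + (4 + 7 * N + 5 * N ^ 2) * M ^ 3) / 6 := by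
  have hlast : ∀ j ∈ range N, columnSum M (dBound N) N j + columnSum M (dBound N) j N =
      2 + 5 * M / 3 + 4 * M * N + 3 * M ^ 2 + 2 * M ^ 2 * N + 4 * M ^ 3 / 3 + 2 * N
        - (2 + 4 * M + 2 * M ^ 2) * j := by
    intro j hj
    rw [mem_range] at hj
    rw [columnSum_dBound_last hj, columnSum_dBound_of_gt hj le_rfl]
    ring
  rw [sum_square_succ, columnSum_dBound_diag_last, sum_congr rfl hlast,
    sum_square_of_affine (p := M / 3 + M * N + M ^ 2 + M ^ 2 * N + 2 * M ^ 3 / 3)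
      (q := -(M + M ^ 2))
      (α := 2 + 4 * M / 3 + 3 * M * N + 3 * M ^ 2 + 3 * M ^ 2 * N + 5 * M ^ 3 / 3 + 2 * N)
      (β := M - M ^ 2) (γ := -(2 + 4 * M + 2 * M ^ 2)) (δ := 0) (g := 0)]
  · simp only [sum_sub_distrib, ← mul_sum, sum_const, card_range, nsmul_eq_mul, sum_range_cast]
    ring
  · intro i hi
    rw [columnSum_dBound_of_le le_rfl hi, if_pos rfl]
    ring
  · intro i hi j hj
    rw [columnSum_dBound_of_le hj.le hi, columnSum_dBound_of_gt hj hi.le, if_neg hj.ne']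
    simp only [Pi.zero_apply]
    ring

open Finset in
theorem sum_dBound_lt_sum_combBound {M k : ℕ} (h : 3 ≤ M ∧ 1 ≤ k ∨ 2 ≤ M ∧ 2 ≤ k) :
    ∑ u : Fin (M + 1) × Fin (2 * k + 1 + 1), ∑ v : Fin (M + 1) × Fin (2 * k + 1 + 1),
        dBound (2 * k + 1) u.1 u.2 v.1 v.2 <
      ∑ u : Fin (M + 1) × Fin (2 * k + 1 + 1), ∑ v : Fin (M + 1) × Fin (2 * k + 1 + 1),
        combBound M (2 * k + 1) u.1 u.2 v.1 v.2 := by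
  rw [← Int.cast_lt (R := ℚ), sum_vertices_eq_columnSum, sum_vertices_eq_columnSum,
    sum_columnSum_combBound, sum_columnSum_dBound, ← sub_pos]
  rcases h with ⟨hM, hk⟩ | ⟨hM, hk⟩ <;>
  · obtain ⟨x, rfl⟩ := Nat.exists_eq_add_of_le hM
    obtain ⟨y, rfl⟩ := Nat.exists_eq_add_of_le hk
    push_cast
    ring_nf
    positivity

/-! #### The grid with three rows and four columns -/

/-- A lower bound for the distances in the comb orientation of the grid with three rows and four
columns, improving on `combBound`. -/
def smallCombBound (u v : Fin 3 × Fin 4) : ℤ :=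
  combBound 2 3 u.1 u.2 v.1 v.2 +
    if u ∈ [(1, 0), (1, 1), (2, 0)] ∧ v ∈ [(1, 2), (1, 3), (2, 3)] ∨
      u ∈ [(2, 1), (2, 2)] ∧ v = (2, 3) then 2 else 0

instance (m n : ℕ) (p q : Fin m × Fin n) : Decidable (CombArc m n p q) :=
  inferInstanceAs (Decidable (_ ∨ _))

theorem smallCombBound_le_of_combArc :
    ∀ v p q, CombArc 3 4 p q → smallCombBound p v ≤ smallCombBound q v + 1 := by
  decide +kernel

theorem smallCombBound_le_ddist (u v : Fin 3 × Fin 4) :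
    smallCombBound u v ≤ ddist (CombArc 3 4) u v := by
  have hself : ∀ v, smallCombBound v v = 0 := by decide +kernel
  have := sub_le_ddist (φ := fun p => smallCombBound p v) (smallCombBound_le_of_combArc v)
    (combArc_reaches le_rfl (by decide) u v)
  simpa [hself] using this

theorem sum_dBound_lt_sum_smallCombBound :
    ∑ u : Fin 3 × Fin 4, ∑ v : Fin 3 × Fin 4, dBound 3 u.1 u.2 v.1 v.2 <
      ∑ u : Fin 3 × Fin 4, ∑ v : Fin 3 × Fin 4, smallCombBound u v := by
  decide +kernel

/-! ### Wiener indices -/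

theorem wiener_lt_wiener {V : Type*} [Fintype V] {A B : V → V → Prop} {L U : V → V → ℤ}
    (hL : ∀ u v, L u v ≤ ddist A u v) (hU : ∀ u v, ddist B u v ≤ U u v)
    (h : ∑ u, ∑ v, U u v < ∑ u, ∑ v, L u v) : wiener B < wiener A := by
  zify [wiener]
  calc ∑ u, ∑ v, (ddist B u v : ℤ) ≤ ∑ u, ∑ v, U u v :=
        Finset.sum_le_sum fun u _ => Finset.sum_le_sum fun v _ => hU u v
    _ < ∑ u, ∑ v, L u v := h
    _ ≤ ∑ u, ∑ v, (ddist A u v : ℤ) :=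
        Finset.sum_le_sum fun u _ => Finset.sum_le_sum fun v _ => hL u v

/-- Theorem 4: for `m ≥ 3` and even `n ≥ 4`, the comb orientation of the grid has
strictly larger Wiener index than the orientation `D_{m,n}`. -/
theorem wiener_comb_gt_wiener_D (m n : ℕ) (hm : 3 ≤ m) (hn : 4 ≤ n) (hne : Even n) :
    wiener (CombArc m n) > wiener (DArc m n) := by
  obtain ⟨M, rfl⟩ : ∃ M, m = M + 1 := ⟨m - 1, by omega⟩
  obtain ⟨k, rfl⟩ : ∃ k, n = 2 * k + 1 + 1 := by
    obtain ⟨l, rfl⟩ := hne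
    exact ⟨l - 1, by omega⟩
  have hU := ddist_le_dBound (M := M) (N := 2 * k + 1) (by omega) (by omega)
  by_cases h : 3 ≤ M ∧ 1 ≤ k ∨ 2 ≤ M ∧ 2 ≤ k
  · exact wiener_lt_wiener (combBound_le_ddist (by omega) (odd_two_mul_add_one k)) hU
      (sum_dBound_lt_sum_combBound h)
  · obtain rfl : M = 2 := by omega
    obtain rfl : k = 1 := by omega
    exact wiener_lt_wiener smallCombBound_le_ddist hU sum_dBound_lt_sum_smallCombBound
end
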